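/- arXiv:2512.03773 — 2 statements merged into one kernel-verified Lean document; each statement's English description precedes it below -/
import Mathlib

section
/- Let n ≥ 1, let p be a Schrödinger-type symbol on ℝ^{2n} and let E₀ > 0. Assume that the trapped set K(E₀) equals {ρ₁, ρ₂} ∪ 𝓗, where ρ₁ ≠ ρ₂ are hyperbolic fixed points of H_p at energy E₀ and 𝓗 is the union of the images of the heteroclinic trajectories from ρ₁ to ρ₂. Then there exist δ > 0, c > 0 and a smooth function G : ℝ^{2n} → ℝ such that G(x,ξ) = x·ξ outside a compact set and H_p G(ρ) ≥ c · min( dist(ρ, {ρ₁, ρ₂})², 1 ) for every ρ ∈ p⁻¹([E₀ − δ, E₀ + δ]). -/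
open Matrix Filter

/-- The Hamiltonian vector field `H_p = (∂_ξ p, −∂_x p)` of a symbol
`p : ℝⁿ × ℝⁿ → ℝ` (coordinates `(x, ξ)`). -/
noncomputable def Hvf {n : ℕ} (p : (Fin n → ℝ) × (Fin n → ℝ) → ℝ)
    (ρ : (Fin n → ℝ) × (Fin n → ℝ)) : (Fin n → ℝ) × (Fin n → ℝ) :=
  (fun i => fderiv ℝ p ρ (0, Pi.single i 1),
   fun i => -fderiv ℝ p ρ (Pi.single i 1, 0))

/-- The trapped set `K(E₀)`: points of the energy surface `p = E₀` through which there is a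
complete bounded Hamiltonian trajectory. -/
def trappedSet {n : ℕ} (p : (Fin n → ℝ) × (Fin n → ℝ) → ℝ) (E₀ : ℝ) :
    Set ((Fin n → ℝ) × (Fin n → ℝ)) :=
  {ρ | p ρ = E₀ ∧ ∃ γ : ℝ → (Fin n → ℝ) × (Fin n → ℝ), γ 0 = ρ ∧
    (∀ t : ℝ, HasDerivAt γ (Hvf p (γ t)) t) ∧ Bornology.IsBounded (Set.range γ)}

/-- The union `𝓗` of the images of the heteroclinic Hamiltonian trajectories of `p`
from `ρ₁` to `ρ₂`. -/
def heteroclinicSet {n : ℕ} (p : (Fin n → ℝ) × (Fin n → ℝ) → ℝ)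
    (ρ₁ ρ₂ : (Fin n → ℝ) × (Fin n → ℝ)) : Set ((Fin n → ℝ) × (Fin n → ℝ)) :=
  {ρ | ∃ γ : ℝ → (Fin n → ℝ) × (Fin n → ℝ),
    (∀ t : ℝ, HasDerivAt γ (Hvf p (γ t)) t) ∧
    Tendsto γ atBot (nhds ρ₁) ∧ Tendsto γ atTop (nhds ρ₂) ∧ ρ ∈ Set.range γ}

/-- A Schrödinger-type symbol: `p(x,ξ) = a(x)ξ·ξ + b(x)·ξ + c(x)` with `a` smooth symmetric
uniformly elliptic, `b`, `c` smooth, and `a − Id`, `b`, `c` compactly supported. -/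
def IsSchrodingerSymbol {n : ℕ} (p : (Fin n → ℝ) × (Fin n → ℝ) → ℝ) : Prop :=
  ∃ (a : (Fin n → ℝ) → Matrix (Fin n) (Fin n) ℝ)
    (b : (Fin n → ℝ) → Fin n → ℝ) (c : (Fin n → ℝ) → ℝ) (δ : ℝ),
    (∀ i j, ContDiff ℝ (⊤ : ℕ∞) fun x => a x i j) ∧
    ContDiff ℝ (⊤ : ℕ∞) b ∧ ContDiff ℝ (⊤ : ℕ∞) c ∧
    (∀ x, (a x).IsSymm) ∧ 0 < δ ∧
    (∀ x v, δ * ∑ i, v i ^ 2 ≤ (a x).mulVec v ⬝ᵥ v) ∧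
    HasCompactSupport (fun x => a x - 1) ∧
    HasCompactSupport b ∧ HasCompactSupport c ∧
    ∀ x ξ, p (x, ξ) = (a x).mulVec ξ ⬝ᵥ ξ + b x ⬝ᵥ ξ + c x

/-- The standard symplectic form `ω((x,ξ),(y,η)) = ξ·y − x·η` on `ℝⁿ × ℝⁿ`. -/
def stdSymplectic {n : ℕ} (u v : (Fin n → ℝ) × (Fin n → ℝ)) : ℝ :=
  (∑ i, u.2 i * v.1 i) - ∑ i, u.1 i * v.2 i

/-- `ρ₀` is a hyperbolic fixed point of `H_p` at energy `E₀`: `H_p(ρ₀) = 0`, `p(ρ₀) = E₀`,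
and after a smooth symplectic change of variables fixing `ρ₀`, the symbol takes the normal
form `E₀ + Σ λₖ/2((ξₖ−ξ₀ₖ)² − (xₖ−x₀ₖ)²) + O(|ρ − ρ₀|³)` with all `λₖ > 0`. -/
def IsHyperbolicFixedPt {n : ℕ} (p : (Fin n → ℝ) × (Fin n → ℝ) → ℝ) (E₀ : ℝ)
    (ρ₀ : (Fin n → ℝ) × (Fin n → ℝ)) : Prop :=
  Hvf p ρ₀ = 0 ∧ p ρ₀ = E₀ ∧
  ∃ (U : Set ((Fin n → ℝ) × (Fin n → ℝ)))
    (κ : (Fin n → ℝ) × (Fin n → ℝ) → (Fin n → ℝ) × (Fin n → ℝ))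
    (lam : Fin n → ℝ) (C : ℝ),
    IsOpen U ∧ ρ₀ ∈ U ∧ ContDiffOn ℝ (⊤ : ℕ∞) κ U ∧ Set.InjOn κ U ∧
    IsOpen (κ '' U) ∧ κ ρ₀ = ρ₀ ∧
    (∀ ρ ∈ U, ∀ u v, stdSymplectic (fderiv ℝ κ ρ u) (fderiv ℝ κ ρ v) = stdSymplectic u v) ∧
    (∀ k, 0 < lam k) ∧
    ∀ ρ ∈ U, |p (κ ρ) - (E₀ + ∑ k, lam k / 2 *
      ((ρ.2 k - ρ₀.2 k) ^ 2 - (ρ.1 k - ρ₀.1 k) ^ 2))| ≤ C * ‖ρ - ρ₀‖ ^ 3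


theorem hasDerivAt_reflect {E : Type*} [NormedAddCommGroup E] [NormedSpace ℝ E] {γ : ℝ → E} {w : E}
    {s : ℝ} (h : HasDerivAt γ w (-s)) : HasDerivAt (fun s => γ (-s)) (-w) s := by
  have := h.scomp s (hasDerivAt_neg s)
  rw [neg_one_smul] at this
  exact this

theorem exists_flow_aux {E : Type*} [NormedAddCommGroup E] [NormedSpace ℝ E] [CompleteSpace E]
    (v : E → E) (K M : NNReal) (hK : LipschitzWith K v) (hM : ∀ x, ‖v x‖ ≤ M) (z : E) :
    ∃ γ : ℝ → E, γ 0 = z ∧ ∀ t, HasDerivAt γ (v (γ t)) t := by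
  have h : ∀ T : ℝ, 0 < T → ∃ γ : ℝ → E, γ 0 = z ∧ ∀ t ∈ Set.Ioo (-T) T, HasDerivAt γ (v (γ t)) t := by
    intro T hT
    have h0 : (0:ℝ) ∈ Set.Icc (-T) T := ⟨by linarith, hT.le⟩
    have hPL : IsPicardLindelof (fun _ ↦ v) (⟨0, h0⟩ : Set.Icc (-T) T) z (M * ⟨T, hT.le⟩) 0 M K := by
      apply IsPicardLindelof.of_time_independent
      · intro x _; exact hM x
      · exact hK.lipschitzOnWith
      · simp; exact le_of_eq rfl
    obtain ⟨α, h1, h2⟩ := hPL.exists_eq_forall_mem_Icc_hasDerivWithinAt₀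
    refine ⟨α, h1, fun t ht => ?_⟩
    exact (h2 t (Set.Ioo_subset_Icc_self ht)).hasDerivAt (Icc_mem_nhds ht.1 ht.2)
  choose! g hg0 hg using h
  have hu : ∀ S T : ℝ, 0 < S → 0 < T → S ≤ T → ∀ t ∈ Set.Ioo (-S) S, g S t = g T t := by
    intro S T hS hT hST t ht
    refine ODE_solution_unique_of_mem_Ioo (v := fun _ => v) (s := fun _ => Set.univ) (K := K)
      (a := -S) (b := S) (t₀ := 0) (fun _ _ => hK.lipschitzOnWith) ⟨by linarith, hS⟩
      (fun t ht => ⟨hg S hS t ht, trivial⟩)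
      (fun t ht => ⟨hg T hT t ⟨by linarith [ht.1], by linarith [ht.2]⟩, trivial⟩) ?_ ht
    rw [hg0 S hS, hg0 T hT]
  refine ⟨fun t => g (|t| + 1) t, ?_, fun t => ?_⟩
  · exact hg0 _ (by positivity)
  · have hm : t ∈ Set.Ioo (-(|t|+1)) (|t|+1) := by
      constructor
      · linarith [neg_abs_le t]
      · linarith [le_abs_self t]
    have h1 := hg (|t| + 1) (by positivity) t hm
    refine h1.congr_of_eventuallyEq ?_
    filter_upwards [isOpen_Ioo.mem_nhds hm] with s hs
    have hs' : |s| + 1 ≤ |t| + 1 ∨ |t| + 1 ≤ |s| + 1 := le_total _ _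
    have hms : s ∈ Set.Ioo (-(|s|+1)) (|s|+1) := by
      constructor
      · linarith [neg_abs_le s]
      · linarith [le_abs_self s]
    rcases hs' with h | h
    · exact hu _ _ (by positivity) (by positivity) h s hms
    · exact (hu _ _ (by positivity) (by positivity) h s hs).symm

theorem traj_dist_le {E : Type*} [NormedAddCommGroup E] [NormedSpace ℝ E]
    (v : E → E) (K : NNReal) (hK : LipschitzWith K v) (f g : ℝ → E)
    (hf : ∀ t, HasDerivAt f (v (f t)) t) (hg : ∀ t, HasDerivAt g (v (g t)) t) (t : ℝ) (ht : 0 ≤ t) :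
    dist (f t) (g t) ≤ Real.exp (K * t) * dist (f 0) (g 0) := by
  have := dist_le_of_trajectories_ODE (v := fun _ => v) (K := K) (f := f) (g := g) (a := 0) (b := t)
    (δ := dist (f 0) (g 0)) (fun _ => hK)
    (fun s _ => (hf s).continuousAt.continuousWithinAt) (fun s _ => (hf s).hasDerivWithinAt)
    (fun s _ => (hg s).continuousAt.continuousWithinAt) (fun s _ => (hg s).hasDerivWithinAt) le_rfl
    t ⟨ht, le_rfl⟩
  rw [sub_zero] at this
  linarith

/-- A global flow of a bounded Lipschitz vector field. -/
structure IsFlow {E : Type*} [NormedAddCommGroup E] [NormedSpace ℝ E]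
    (v : E → E) (K : NNReal) (φ : ℝ → E → E) : Prop where
  zero : ∀ z, φ 0 z = z
  deriv : ∀ z t, HasDerivAt (fun s => φ s z) (v (φ t z)) t
  add : ∀ s t z, φ (s + t) z = φ s (φ t z)
  lip : ∀ t z w, dist (φ t z) (φ t w) ≤ Real.exp (K * |t|) * dist z w
  uniq : ∀ γ : ℝ → E, (∀ t, HasDerivAt γ (v (γ t)) t) → ∀ t, γ t = φ t (γ 0)

theorem exists_flow {E : Type*} [NormedAddCommGroup E] [NormedSpace ℝ E] [CompleteSpace E]
    (v : E → E) (K M : NNReal) (hK : LipschitzWith K v) (hM : ∀ x, ‖v x‖ ≤ M) :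
    ∃ φ : ℝ → E → E, IsFlow v K φ := by
  choose g hg0 hg using exists_flow_aux v K M hK hM
  have huniq : ∀ γ : ℝ → E, (∀ t, HasDerivAt γ (v (γ t)) t) → ∀ t, γ t = g (γ 0) t := by
    intro γ hγ t
    have := ODE_solution_unique_univ (v := fun _ => v) (s := fun _ => Set.univ) (K := K)
      (f := γ) (g := g (γ 0)) (t₀ := 0) (fun _ => hK.lipschitzOnWith) (fun t => ⟨hγ t, trivial⟩)
      (fun t => ⟨hg _ t, trivial⟩) (hg0 _).symm
    exact congrFun this t
  refine ⟨fun t z => g z t, hg0, fun z t => hg z t, ?_, ?_, huniq⟩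
  · intro s t z
    have h := huniq (fun s => g z (s + t)) (fun s => by
      have := (hg z (s + t)).comp_add_const s t
      exact this) s
    simpa using h
  · intro t z w
    rcases le_total 0 t with ht | ht
    · have := traj_dist_le v K hK (g z) (g w) (hg z) (hg w) t ht
      rw [hg0, hg0] at this
      rwa [abs_of_nonneg ht]
    · have h2 : ∀ z s, HasDerivAt (fun s => g z (-s)) ((fun x => - v x) (g z (-s))) s := by
        intro z s
        exact hasDerivAt_reflect (hg z (-s))
      have hKn : LipschitzWith K (fun x => - v x) := by
        exact hK.neg
      have := traj_dist_le (fun x => - v x) K hKn (fun s => g z (-s)) (fun s => g w (-s))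
        (h2 z) (h2 w) (-t) (by linarith)
      simp only [neg_neg, neg_zero, hg0] at this
      rwa [← abs_of_nonpos ht] at this

theorem IsFlow.continuous {E : Type*} [NormedAddCommGroup E] [NormedSpace ℝ E]
    {v : E → E} {K : NNReal} {φ : ℝ → E → E} (h : IsFlow v K φ) (t : ℝ) : Continuous (φ t) := by
  have : LipschitzWith ⟨Real.exp (K * |t|), (Real.exp_pos _).le⟩ (φ t) :=
    LipschitzWith.of_dist_le_mul (fun z w => h.lip t z w)
  exact this.continuous

theorem IsFlow.continuous_time {E : Type*} [NormedAddCommGroup E] [NormedSpace ℝ E]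
    {v : E → E} {K : NNReal} {φ : ℝ → E → E} (h : IsFlow v K φ) (z : E) :
    Continuous (fun t => φ t z) :=
  continuous_iff_continuousAt.2 fun t => (h.deriv z t).continuousAt

theorem IsFlow.neg {E : Type*} [NormedAddCommGroup E] [NormedSpace ℝ E]
    {v : E → E} {K : NNReal} {φ : ℝ → E → E} (h : IsFlow v K φ) :
    IsFlow (fun x => - v x) K (fun t z => φ (-t) z) where
  zero z := by simpa using h.zero z
  deriv z t := by
    exact hasDerivAt_reflect (h.deriv z (-t))
  add s t z := by
    show φ (-(s+t)) z = φ (-s) (φ (-t) z)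
    rw [← h.add]; congr 1; ring
  lip t z w := by simpa using h.lip (-t) z w
  uniq γ hγ t := by
    have := h.uniq (fun s => γ (-s)) (fun s => by
      have := hasDerivAt_reflect (hγ (-s))
      rwa [neg_neg] at this) (-t)
    simpa using this

theorem IsFlow.fixed {E : Type*} [NormedAddCommGroup E] [NormedSpace ℝ E]
    {v : E → E} {K : NNReal} {φ : ℝ → E → E} (h : IsFlow v K φ) (z : E) (hz : v z = 0) (t : ℝ) :
    φ t z = z := by
  have := h.uniq (fun _ => z) (fun t => by rw [hz]; exact hasDerivAt_const t z) t
  exact this.symm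


/-- Abstract dynamical situation: a flow with conserved energy `p`, an escape region `q > R`
and a trapped set made of two fixed points and heteroclinic trajectories. -/
structure Dyn {E : Type*} [NormedAddCommGroup E] (K : NNReal) (φ : ℝ → E → E)
    (p q : E → ℝ) (R E₀ δ₀ : ℝ) (ρ₁ ρ₂ : E) : Prop where
  zero : ∀ z, φ 0 z = z
  add : ∀ s t z, φ (s + t) z = φ s (φ t z)
  lip : ∀ t z w, dist (φ t z) (φ t w) ≤ Real.exp (K * |t|) * dist z w
  cont : ∀ z, Continuous (fun t => φ t z)
  p_inv : ∀ t z, p (φ t z) = p z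
  p_cont : Continuous p
  q_cont : Continuous q
  pos : 0 < δ₀
  cpt : IsCompact {z | q z ≤ R ∧ |p z - E₀| ≤ δ₀}
  d0 : ∀ z, |p z - E₀| ≤ δ₀ → ∀ u t w, u ≤ t → t ≤ w → q (φ u z) ≤ R → q (φ w z) ≤ R →
    q (φ t z) ≤ R
  trap : ∀ z, p z = E₀ → (∀ t, q (φ t z) ≤ R) → z = ρ₁ ∨ z = ρ₂ ∨
    (Tendsto (fun t => φ t z) atBot (nhds ρ₁) ∧ Tendsto (fun t => φ t z) atTop (nhds ρ₂))
  fix₁ : ∀ t, φ t ρ₁ = ρ₁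
  fix₂ : ∀ t, φ t ρ₂ = ρ₂
  e₁ : p ρ₁ = E₀
  e₂ : p ρ₂ = E₀
  q₁ : q ρ₁ < R
  q₂ : q ρ₂ < R
  ne : ρ₁ ≠ ρ₂

namespace Dyn
variable {E : Type*} [NormedAddCommGroup E] {K : NNReal} {φ : ℝ → E → E}
    {p q : E → ℝ} {R E₀ δ₀ : ℝ} {ρ₁ ρ₂ : E}

theorem reverse (h : Dyn K φ p q R E₀ δ₀ ρ₁ ρ₂) :
    Dyn K (fun t => φ (-t)) p q R E₀ δ₀ ρ₂ ρ₁ where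
  zero z := by simpa using h.zero z
  add s t z := by
    show φ (-(s+t)) z = φ (-s) (φ (-t) z)
    rw [← h.add]; congr 1; ring
  lip t z w := by simpa using h.lip (-t) z w
  cont z := (h.cont z).comp continuous_neg
  p_inv t z := h.p_inv _ z
  p_cont := h.p_cont
  q_cont := h.q_cont
  pos := h.pos
  cpt := h.cpt
  d0 z hz u t w h1 h2 h3 h4 := h.d0 z hz (-w) (-t) (-u) (by linarith) (by linarith) h4 h3
  trap z hz hq := by
    rcases h.trap z hz (fun t => by simpa using hq (-t)) with h1 | h1 | ⟨h1, h2⟩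
    · exact Or.inr (Or.inl h1)
    · exact Or.inl h1
    · exact Or.inr (Or.inr ⟨h2.comp tendsto_neg_atBot_atTop, h1.comp tendsto_neg_atTop_atBot⟩)
  fix₁ t := h.fix₂ _
  fix₂ t := h.fix₁ _
  e₁ := h.e₂
  e₂ := h.e₁
  q₁ := h.q₂
  q₂ := h.q₁
  ne := h.ne.symm

theorem contz (h : Dyn K φ p q R E₀ δ₀ ρ₁ ρ₂) (t : ℝ) : Continuous (φ t) := by
  have : LipschitzWith ⟨Real.exp (K * |t|), (Real.exp_pos _).le⟩ (φ t) :=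
    LipschitzWith.of_dist_le_mul (fun z w => h.lip t z w)
  exact this.continuous

theorem limit (h : Dyn K φ p q R E₀ δ₀ ρ₁ ρ₂) (z : ℕ → E) (a b : ℕ → ℝ)
    (hz : ∀ k, |p (z k) - E₀| ≤ δ₀) (hz' : Tendsto (fun k => p (z k)) atTop (nhds E₀))
    (hq : ∀ k, ∀ t, -a k ≤ t → t ≤ b k → q (φ t (z k)) ≤ R)
    (ha : Tendsto a atTop atTop) (hb : Tendsto b atTop atTop) (ha0 : ∀ k, 0 ≤ a k)
    (hb0 : ∀ k, 0 ≤ b k) :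
    ∃ (w : E) (ψ : ℕ → ℕ), StrictMono ψ ∧ p w = E₀ ∧ (∀ t, q (φ t w) ≤ R) ∧
      ∀ t, Tendsto (fun k => φ t (z (ψ k))) atTop (nhds (φ t w)) := by
  obtain ⟨w, -, ψ, hψ, hw⟩ := h.cpt.tendsto_subseq (x := z) (fun k => ⟨by
    have := hq k 0 (by linarith [ha0 k]) (hb0 k)
    rwa [h.zero] at this, hz k⟩)
  have hlim : ∀ t, Tendsto (fun k => φ t (z (ψ k))) atTop (nhds (φ t w)) := fun t =>
    ((h.contz t).tendsto w).comp hw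
  refine ⟨w, ψ, hψ, ?_, ?_, hlim⟩
  · exact tendsto_nhds_unique ((h.p_cont.tendsto w).comp hw) (hz'.comp hψ.tendsto_atTop)
  · intro t
    refine le_of_tendsto ((h.q_cont.tendsto _).comp (hlim t)) ?_
    filter_upwards [(ha.comp hψ.tendsto_atTop).eventually_ge_atTop (-t),
      (hb.comp hψ.tendsto_atTop).eventually_ge_atTop t] with k h1 h2
    exact hq _ t (by simp at h1; linarith) h2

theorem visit (h : Dyn K φ p q R E₀ δ₀ ρ₁ ρ₂) (s : ℝ) (hs : 0 < s) :
    ∃ δ T : ℝ, 0 < δ ∧ δ ≤ δ₀ ∧ 0 < T ∧ ∀ z, |p z - E₀| ≤ δ →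
      (∀ t, 0 ≤ t → t ≤ T → q (φ t z) ≤ R) →
      ∃ t, 0 ≤ t ∧ t ≤ T ∧ (dist (φ t z) ρ₁ < s ∨ dist (φ t z) ρ₂ < s) := by
  by_contra! hc
  have hpos := h.pos
  have H : ∀ k : ℕ, ∃ z, |p z - E₀| ≤ min δ₀ (1 / ((k:ℝ) + 1)) ∧
      (∀ t, 0 ≤ t → t ≤ 2 * ((k:ℝ) + 1) → q (φ t z) ≤ R) ∧
      ∀ t, 0 ≤ t → t ≤ 2 * ((k:ℝ)+1) → s ≤ dist (φ t z) ρ₁ ∧ s ≤ dist (φ t z) ρ₂ := fun k => 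
    hc (min δ₀ (1 / ((k:ℝ) + 1))) (2 * ((k:ℝ)+1)) (by positivity) (min_le_left _ _) (by positivity)
  choose y hy1 hy2 hy3 using H
  have hshift : ∀ (k : ℕ) (t : ℝ), φ t (φ ((k:ℝ) + 1) (y k)) = φ (t + ((k:ℝ) + 1)) (y k) := fun k t =>
    (h.add _ _ _).symm
  have htend : Tendsto (fun k : ℕ => (k:ℝ) + 1) atTop atTop :=
    tendsto_atTop_add_const_right _ _ tendsto_natCast_atTop_atTop
  obtain ⟨w, ψ, hψ, hw1, hw2, hw3⟩ := h.limit (fun k => φ ((k:ℝ) + 1) (y k)) (fun k => (k:ℝ)+1)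
    (fun k => (k:ℝ) + 1)
    (fun k => by rw [h.p_inv]; exact (hy1 k).trans (min_le_left _ _))
    (by
      simp only [h.p_inv]
      rw [tendsto_iff_dist_tendsto_zero]
      refine squeeze_zero (fun _ => dist_nonneg) (fun k => ?_) tendsto_one_div_add_atTop_nhds_zero_nat
      rw [Real.dist_eq]
      exact (hy1 k).trans (min_le_right _ _))
    (fun k t h1 h2 => by rw [hshift]; exact hy2 k _ (by linarith) (by linarith))
    htend htend (fun k => by positivity) (fun k => by positivity)
  have hd : ∀ t, s ≤ dist (φ t w) ρ₁ ∧ s ≤ dist (φ t w) ρ₂ := by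
    intro t
    have hev : ∀ᶠ k in atTop, s ≤ dist (φ t (φ ((ψ k:ℝ) + 1) (y (ψ k)))) ρ₁ ∧
        s ≤ dist (φ t (φ ((ψ k:ℝ) + 1) (y (ψ k)))) ρ₂ := by
      filter_upwards [(htend.comp hψ.tendsto_atTop).eventually_ge_atTop |t|] with k hk
      simp at hk
      rw [hshift]
      exact hy3 _ _ (by linarith [neg_abs_le t]) (by linarith [le_abs_self t])
    exact ⟨ge_of_tendsto ((hw3 t).dist tendsto_const_nhds) (hev.mono fun _ h => h.1),
      ge_of_tendsto ((hw3 t).dist tendsto_const_nhds) (hev.mono fun _ h => h.2)⟩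
  rcases h.trap w hw1 hw2 with h1 | h1 | ⟨-, h1⟩
  · have := (hd 0).1; rw [h.zero, h1, dist_self] at this; linarith
  · have := (hd 0).2; rw [h.zero, h1, dist_self] at this; linarith
  · have := ge_of_tendsto (h1.dist (tendsto_const_nhds (x := ρ₂))) (Eventually.of_forall fun t => (hd t).2)
    rw [dist_self] at this; linarith

/-- first exit time. -/
theorem first_exit (f : ℝ → ℝ) (hf : Continuous f) (r u : ℝ) (hu : 0 ≤ u) (h0 : f 0 < r)
    (hr : r ≤ f u) : ∃ t, 0 ≤ t ∧ t ≤ u ∧ f t = r ∧ ∀ s, 0 ≤ s → s ≤ t → f s ≤ r := by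
  let S := {t | t ∈ Set.Icc 0 u ∧ r ≤ f t}
  have hS : IsCompact S := by
    have : S = Set.Icc 0 u ∩ f ⁻¹' (Set.Ici r) := rfl
    rw [this]
    exact isCompact_Icc.inter_right (isClosed_Ici.preimage hf)
  have hne : S.Nonempty := ⟨u, ⟨hu, le_rfl⟩, hr⟩
  have hm := hS.sInf_mem hne
  set t := sInf S
  have hlt : ∀ s, 0 ≤ s → s < t → f s < r := by
    intro s h1 h2
    by_contra hcon
    exact absurd (csInf_le hS.bddBelow (show s ∈ S from ⟨⟨h1, h2.le.trans hm.1.2⟩, not_lt.1 hcon⟩))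
      (not_le.2 h2)
  have hle : f t ≤ r := by
    have ht0 : 0 < t := by
      rcases hm.1.1.lt_or_eq with h | h
      · exact h
      · exfalso; have := hm.2; rw [← h] at this; linarith
    have : Tendsto f (nhdsWithin t (Set.Iio t)) (nhds (f t)) := hf.continuousAt.tendsto.mono_left nhdsWithin_le_nhds
    refine le_of_tendsto this ?_
    filter_upwards [Ioo_mem_nhdsLT ht0] with s hs
    exact (hlt s hs.1.le hs.2).le
  refine ⟨t, hm.1.1, hm.1.2, le_antisymm hle hm.2, fun s h1 h2 => ?_⟩
  rcases h2.lt_or_eq with h | h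
  · exact (hlt s h1 h).le
  · rw [h]; exact hle

theorem no_return (h : Dyn K φ p q R E₀ δ₀ ρ₁ ρ₂) (r : ℝ) (hr : 0 < r) (hr' : r < dist ρ₁ ρ₂) :
    ∃ δ s : ℝ, 0 < δ ∧ δ ≤ δ₀ ∧ 0 < s ∧ ∀ z, |p z - E₀| ≤ δ → ∀ t, 0 ≤ t →
      dist z ρ₂ < s → (dist (φ t z) ρ₁ < s ∨ dist (φ t z) ρ₂ < s) →
      ∀ u, 0 ≤ u → u ≤ t → dist (φ u z) ρ₂ < r := by
  by_contra! hc
  have hpos := h.pos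
  obtain ⟨s₁, hs₁, hq₁⟩ := Metric.isOpen_iff.1 (isOpen_lt h.q_cont continuous_const) ρ₁ h.q₁
  obtain ⟨s₂, hs₂, hq₂⟩ := Metric.isOpen_iff.1 (isOpen_lt h.q_cont continuous_const) ρ₂ h.q₂
  set s₀ := min (min s₁ s₂) r with hs₀
  have hs₀p : 0 < s₀ := by positivity
  have H : ∀ k : ℕ, ∃ z, |p z - E₀| ≤ min δ₀ (1 / ((k:ℝ) + 1)) ∧ ∃ t, 0 ≤ t ∧
      dist z ρ₂ < min s₀ (1 / ((k:ℝ) + 1)) ∧ (dist (φ t z) ρ₁ < min s₀ (1 / ((k:ℝ) + 1)) ∨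
       dist (φ t z) ρ₂ < min s₀ (1 / ((k:ℝ) + 1))) ∧ ∃ u, 0 ≤ u ∧ u ≤ t ∧ r ≤ dist (φ u z) ρ₂ := fun k => 
    hc (min δ₀ (1 / ((k:ℝ) + 1))) (min s₀ (1 / ((k:ℝ) + 1))) (by positivity) (min_le_left _ _) (by positivity)
  choose y hy1 t ht hy2 hy3 u hu0 hut hu using H
  have hex : ∀ k, ∃ τ, 0 ≤ τ ∧ τ ≤ u k ∧ dist (φ τ (y k)) ρ₂ = r ∧
      ∀ s, 0 ≤ s → s ≤ τ → dist (φ s (y k)) ρ₂ ≤ r := fun k =>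
    first_exit (fun s => dist (φ s (y k)) ρ₂) ((h.cont (y k)).dist continuous_const) r (u k) (hu0 k)
      (by rw [h.zero]; exact (hy2 k).trans_le ((min_le_left _ _).trans (min_le_right _ _))) (hu k)
  choose τ hτ0 hτu hτr hτs using hex
  have hδ : 0 < min r (dist ρ₁ ρ₂ - r) := lt_min hr (by linarith)
  set d := min r (dist ρ₁ ρ₂ - r)
  -- a sequence of times with growth must tend to infinity
  have grow : ∀ a : ℕ → ℝ, (∀ k, 0 ≤ a k) → (∀ k, d ≤ Real.exp (K * a k) * (1 / ((k:ℝ) + 1))) →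
      Tendsto a atTop atTop := by
    intro a ha hk
    rw [tendsto_atTop]
    intro B
    have : Tendsto (fun k : ℕ => Real.exp (K * B) * (1 / ((k:ℝ) + 1))) atTop (nhds 0) := by
      simpa using (tendsto_one_div_add_atTop_nhds_zero_nat (𝕜 := ℝ)).const_mul (Real.exp (K * B))
    filter_upwards [this.eventually_lt_const hδ] with k hk'
    by_contra hlt
    push Not at hlt
    have h1 := hk k
    have h2 : Real.exp (K * a k) ≤ Real.exp (K * B) :=
      Real.exp_le_exp.2 (mul_le_mul_of_nonneg_left hlt.le K.2)
    have h3 : Real.exp (K * a k) * (1 / ((k:ℝ) + 1)) ≤ Real.exp (K * B) * (1 / ((k:ℝ) + 1)) :=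
      mul_le_mul_of_nonneg_right h2 (by positivity)
    linarith
  have hτt : ∀ k, τ k ≤ t k := fun k => (hτu k).trans (hut k)
  have g1 : Tendsto τ atTop atTop := by
    apply grow τ hτ0
    intro k
    have := h.lip (τ k) (y k) ρ₂
    rw [h.fix₂, hτr, abs_of_nonneg (hτ0 k)] at this
    refine (min_le_left _ _).trans (this.trans ?_)
    exact mul_le_mul_of_nonneg_left ((hy2 k).le.trans (min_le_right _ _)) (Real.exp_pos _).le
  have hshift : ∀ k s, φ s (φ (τ k) (y k)) = φ (s + τ k) (y k) := fun k s => (h.add _ _ _).symm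
  have g2 : Tendsto (fun k => t k - τ k) atTop atTop := by
    apply grow _ (fun k => by linarith [hτt k])
    intro k
    have hback : φ (-(t k - τ k)) (φ (t k) (y k)) = φ (τ k) (y k) := by
      rw [← h.add]; congr 1; ring
    have habs : |(-(t k - τ k))| = t k - τ k := by
      rw [abs_neg, abs_of_nonneg (by linarith [hτt k])]
    rcases hy3 k with h3 | h3
    · have := h.lip (-(t k - τ k)) (φ (t k) (y k)) ρ₁
      rw [h.fix₁, hback, habs] at this
      have htri := dist_triangle_left ρ₁ ρ₂ (φ (τ k) (y k))
      rw [hτr] at htri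
      refine (min_le_right _ _).trans (le_trans (by linarith) (this.trans ?_))
      exact mul_le_mul_of_nonneg_left (h3.le.trans (min_le_right _ _)) (Real.exp_pos _).le
    · have := h.lip (-(t k - τ k)) (φ (t k) (y k)) ρ₂
      rw [h.fix₂, hback, habs, hτr] at this
      refine (min_le_left _ _).trans (this.trans ?_)
      exact mul_le_mul_of_nonneg_left (h3.le.trans (min_le_right _ _)) (Real.exp_pos _).le
  obtain ⟨w, ψ, hψ, hw1, hw2, hw3⟩ := h.limit (fun k => φ (τ k) (y k)) τ (fun k => t k - τ k)
    (fun k => by rw [h.p_inv]; exact (hy1 k).trans (min_le_left _ _))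
    (by
      simp only [h.p_inv]
      rw [tendsto_iff_dist_tendsto_zero]
      refine squeeze_zero (fun _ => dist_nonneg) (fun k => ?_) tendsto_one_div_add_atTop_nhds_zero_nat
      rw [Real.dist_eq]
      exact (hy1 k).trans (min_le_right _ _))
    (fun k s h1 h2 => by
      rw [hshift]
      refine h.d0 (y k) ((hy1 k).trans (min_le_left _ _)) 0 (s + τ k) (t k) (by linarith) (by linarith) ?_ ?_
      · rw [h.zero]
        exact (hq₂ (show y k ∈ Metric.ball ρ₂ s₂ from (hy2 k).trans_le ((min_le_left _ _).trans
          ((min_le_left _ _).trans (min_le_right _ _))))).le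
      · rcases hy3 k with h3 | h3
        · exact (hq₁ (show φ (t k) (y k) ∈ Metric.ball ρ₁ s₁ from h3.trans_le ((min_le_left _ _).trans
            ((min_le_left _ _).trans (min_le_left _ _))))).le
        · exact (hq₂ (show φ (t k) (y k) ∈ Metric.ball ρ₂ s₂ from h3.trans_le ((min_le_left _ _).trans
            ((min_le_left _ _).trans (min_le_right _ _))))).le)
    g1 g2 hτ0 (fun k => by linarith [hτt k])
  have hdr : dist w ρ₂ = r := by
    have h1 := (hw3 0).dist (tendsto_const_nhds (x := ρ₂))
    simp only [h.zero, hτr] at h1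
    exact (tendsto_nhds_unique h1 tendsto_const_nhds)
  have hdle : ∀ s ≤ 0, dist (φ s w) ρ₂ ≤ r := by
    intro s hs
    refine le_of_tendsto ((hw3 s).dist tendsto_const_nhds) ?_
    filter_upwards [(g1.comp hψ.tendsto_atTop).eventually_ge_atTop (-s)] with k hk
    simp at hk
    rw [hshift]
    exact hτs _ _ (by linarith) (by linarith)
  rcases h.trap w hw1 hw2 with h1 | h1 | ⟨h1, -⟩
  · rw [h1] at hdr; linarith
  · rw [h1, dist_self] at hdr; linarith
  · have := le_of_tendsto (h1.dist (tendsto_const_nhds (x := ρ₂)))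
      ((eventually_le_atBot 0).mono fun s hs => hdle s hs)
    linarith

/-- combined no-return statement -/
theorem no_return' (h : Dyn K φ p q R E₀ δ₀ ρ₁ ρ₂) (r : ℝ) (hr : 0 < r) (hr' : 2 * r < dist ρ₁ ρ₂) :
    ∃ δ s : ℝ, 0 < δ ∧ δ ≤ δ₀ ∧ 0 < s ∧ s ≤ r ∧ ∀ z, |p z - E₀| ≤ δ → ∀ a b, a ≤ b →
      (dist (φ a z) ρ₁ < s → dist (φ b z) ρ₁ < s → ∀ u, a ≤ u → u ≤ b → dist (φ u z) ρ₁ < r) ∧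
      (dist (φ a z) ρ₂ < s → dist (φ b z) ρ₂ < s → ∀ u, a ≤ u → u ≤ b → dist (φ u z) ρ₂ < r) ∧
      ¬ (dist (φ a z) ρ₂ < s ∧ dist (φ b z) ρ₁ < s) := by
  have hd : dist ρ₂ ρ₁ = dist ρ₁ ρ₂ := dist_comm _ _
  obtain ⟨δ, s, h1, h2, h3, h4⟩ := h.no_return r hr (by linarith)
  obtain ⟨δ', s', h1', h2', h3', h4'⟩ := h.reverse.no_return r hr (by linarith)
  refine ⟨min δ δ', min r (min s s'), by positivity, (min_le_left _ _).trans h2, by positivity,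
    min_le_left _ _, fun z hz a b hab => ?_⟩
  have ms : min r (min s s') ≤ s := (min_le_right _ _).trans (min_le_left _ _)
  have ms' : min r (min s s') ≤ s' := (min_le_right _ _).trans (min_le_right _ _)
  have hf : ∀ u, φ (u - a) (φ a z) = φ u z := fun u => by rw [← h.add]; congr 1; ring
  have hb : ∀ u, φ (-(b - u)) (φ b z) = φ u z := fun u => by rw [← h.add]; congr 1; ring
  refine ⟨fun ha hb' u hau hub => ?_, fun ha hb' u hau hub => ?_, fun ⟨ha, hb'⟩ => ?_⟩
  · have := h4' (φ b z) (by rw [h.p_inv]; exact hz.trans (min_le_right _ _)) (b - a) (by linarith)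
      (hb'.trans_le ms') (Or.inr (by simp only [hb]; exact ha.trans_le ms')) (b - u) (by linarith) (by linarith)
    simpa only [hb] using this
  · have := h4 (φ a z) (by rw [h.p_inv]; exact hz.trans (min_le_left _ _)) (b - a) (by linarith)
      (ha.trans_le ms) (Or.inr (by simp only [hf]; exact hb'.trans_le ms)) (u - a) (by linarith) (by linarith)
    simpa only [hf] using this
  · have := h4 (φ a z) (by rw [h.p_inv]; exact hz.trans (min_le_left _ _)) (b - a) (by linarith)
      (ha.trans_le ms) (Or.inl (by simp only [hf]; exact hb'.trans_le ms)) (b - a) (by linarith) (by linarith)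
    simp only [hf] at this
    have h5 := dist_triangle_left ρ₁ ρ₂ (φ b z)
    have h6 : dist (φ b z) ρ₁ < r := hb'.trans_le (min_le_left _ _)
    linarith

end Dyn


theorem integral_window (g : ℝ → ℝ) (hg : Continuous g) (h0 : ∀ t, 0 ≤ g t) (h1 : ∀ t, g t ≤ 1)
    (a b T : ℝ) (hT : 0 ≤ T) (hab : a ≤ b)
    (hS : ∀ t t', a ≤ t → t ≤ t' → t' ≤ b → g t ≠ 0 → g t' ≠ 0 → t' - t ≤ T) :
    ∫ t in a..b, g t ≤ 2 * T := by
  by_cases hne : ∃ t₀, a ≤ t₀ ∧ t₀ ≤ b ∧ g t₀ ≠ 0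
  · obtain ⟨t₀, hat, htb, hgt⟩ := hne
    have hz : ∀ t, a ≤ t → t ≤ b → (t < t₀ - T ∨ t₀ + T < t) → g t = 0 := by
      intro t h2 h3 h4
      by_contra h5
      rcases h4 with h4 | h4
      · have := hS t t₀ h2 (by linarith) htb h5 hgt; linarith
      · have := hS t₀ t hat (by linarith) h3 hgt h5; linarith
    have hle : ∫ t in a..b, g t ≤ ∫ t in a..b, (Set.Icc (t₀ - T) (t₀ + T)).indicator (fun _ => (1:ℝ)) t := by
      apply intervalIntegral.integral_mono_on hab (hg.intervalIntegrable _ _)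
      · rw [intervalIntegrable_iff]
        exact (MeasureTheory.integrable_indicator_iff measurableSet_Icc |>.2
          (by simp)).integrableOn
      · intro t ht
        by_cases hm : t ∈ Set.Icc (t₀ - T) (t₀ + T)
        · rw [Set.indicator_of_mem hm]; exact h1 t
        · rw [Set.indicator_of_notMem hm]
          rw [Set.mem_Icc, not_and_or, not_le, not_le] at hm
          exact (hz t ht.1 ht.2 hm).le
    refine hle.trans ?_
    rw [intervalIntegral.integral_of_le hab]
    have : ∫ t in Set.Ioc a b, (Set.Icc (t₀ - T) (t₀ + T)).indicator (fun _ => (1:ℝ)) t ≤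
        ∫ t, (Set.Icc (t₀ - T) (t₀ + T)).indicator (fun _ => (1:ℝ)) t := by
      apply MeasureTheory.setIntegral_le_integral
      · exact (MeasureTheory.integrable_indicator_iff measurableSet_Icc |>.2 (by simp))
      · exact Eventually.of_forall fun t => Set.indicator_nonneg (fun _ _ => zero_le_one) t
    refine this.trans ?_
    rw [MeasureTheory.integral_indicator measurableSet_Icc]
    simp only [MeasureTheory.integral_const, smul_eq_mul, mul_one, MeasureTheory.measureReal_restrict_apply_univ, Real.volume_real_Icc]
    rw [max_eq_left (by linarith)]
    linarith
  · push Not at hne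
    rw [intervalIntegral.integral_congr (g := fun _ => (0:ℝ))]
    · simp; exact hT
    · intro t ht
      rw [Set.uIcc_of_le hab] at ht
      exact hne t ht.1 ht.2

/-- Removing the hull of the visits to an open set. -/
theorem hull_split (g : ℝ → ℝ) (V : Set ℝ)
    (hV : ∀ c d, c ∈ V → d ∈ V → ∀ u, c ≤ u → u ≤ d → g u = 0) (a b : ℝ) (hab : a ≤ b) :
    ∃ c d, a ≤ c ∧ c ≤ d ∧ d ≤ b ∧ (∀ t, a < t → t < c → t ∉ V) ∧ (∀ t, d < t → t < b → t ∉ V) ∧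
      ∫ t in c..d, g t = 0 := by
  by_cases hne : (V ∩ Set.Icc a b).Nonempty
  · have hbb : BddBelow (V ∩ Set.Icc a b) := ⟨a, fun t ht => ht.2.1⟩
    have hba : BddAbove (V ∩ Set.Icc a b) := ⟨b, fun t ht => ht.2.2⟩
    refine ⟨sInf (V ∩ Set.Icc a b), sSup (V ∩ Set.Icc a b), le_csInf hne fun t ht => ht.2.1,
      csInf_le_csSup hne hbb hba, csSup_le hne fun t ht => ht.2.2, ?_, ?_, ?_⟩
    · intro t h1 h2 h3
      have h4 : sInf (V ∩ Set.Icc a b) ≤ b := by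
        obtain ⟨x, hx⟩ := hne
        exact (csInf_le hbb hx).trans hx.2.2
      exact absurd (csInf_le hbb (show t ∈ _ from ⟨h3, h1.le, by linarith⟩)) (not_le.2 h2)
    · intro t h1 h2 h3
      have h4 : a ≤ sSup (V ∩ Set.Icc a b) := by
        obtain ⟨x, hx⟩ := hne
        exact hx.2.1.trans (le_csSup hba hx)
      exact absurd (le_csSup hba (show t ∈ _ from ⟨h3, by linarith, h2.le⟩)) (not_le.2 h1)
    · have hcd := csInf_le_csSup hne hbb hba
      rw [intervalIntegral.integral_of_le hcd, MeasureTheory.integral_Ioc_eq_integral_Ioo]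
      apply MeasureTheory.setIntegral_eq_zero_of_forall_eq_zero
      intro u hu
      obtain ⟨c, hc, hcu⟩ := exists_lt_of_csInf_lt hne hu.1
      obtain ⟨d, hd, hdu⟩ := exists_lt_of_lt_csSup hne hu.2
      exact hV c d hc.1 hd.1 u hcu.le hdu.le
  · rw [Set.not_nonempty_iff_eq_empty] at hne
    refine ⟨a, a, le_rfl, le_rfl, hab, fun t h1 h2 => absurd h1 (not_lt.2 h2.le), fun t h1 h2 h3 => ?_, by simp⟩
    have : t ∈ V ∩ Set.Icc a b := ⟨h3, h1.le, h2.le⟩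
    rw [hne] at this
    exact this

namespace Dyn
variable {E : Type*} [NormedAddCommGroup E] {K : NNReal} {φ : ℝ → E → E}
    {p q : E → ℝ} {R E₀ δ₀ : ℝ} {ρ₁ ρ₂ : E}

theorem time_bound (h : Dyn K φ p q R E₀ δ₀ ρ₁ ρ₂) (r : ℝ) (hr : 0 < r) (hr' : 2 * r < dist ρ₁ ρ₂) :
    ∃ δ s T : ℝ, 0 < δ ∧ δ ≤ δ₀ ∧ 0 < s ∧ s ≤ r ∧ 0 ≤ T ∧
      (∀ z, |p z - E₀| ≤ δ → ∀ a b, a ≤ b →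
      (dist (φ a z) ρ₁ < s → dist (φ b z) ρ₁ < s → ∀ u, a ≤ u → u ≤ b → dist (φ u z) ρ₁ < r) ∧
      (dist (φ a z) ρ₂ < s → dist (φ b z) ρ₂ < s → ∀ u, a ≤ u → u ≤ b → dist (φ u z) ρ₂ < r) ∧
      ¬ (dist (φ a z) ρ₂ < s ∧ dist (φ b z) ρ₁ < s)) ∧
      ∀ χ : E → ℝ, Continuous χ → (∀ z, 0 ≤ χ z) → (∀ z, χ z ≤ 1) →
        (∀ z, χ z ≠ 0 → q z ≤ R ∧ r ≤ dist z ρ₁ ∧ r ≤ dist z ρ₂) →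
        ∀ z, |p z - E₀| ≤ δ → ∀ a b, a ≤ b → ∫ t in a..b, χ (φ t z) ≤ T := by
  obtain ⟨δ₁, s, d1, d2, s1, s2, H⟩ := h.no_return' r hr hr'
  obtain ⟨δ₂, T, d3, d4, T1, HT⟩ := h.visit s s1
  refine ⟨min δ₁ δ₂, s, 8 * T, by positivity, (min_le_left _ _).trans d2, s1, s2, by positivity,
    fun z hz => H z (hz.trans (min_le_left _ _)), ?_⟩
  intro χ hχ h0 h1 hs z hz a b hab
  have hz1 := hz.trans (min_le_left _ _)
  have hz2 := hz.trans (min_le_right _ _)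
  have hcont : Continuous fun t => χ (φ t z) := hχ.comp (h.cont z)
  have hIntg : ∀ c d, IntervalIntegrable (fun t => χ (φ t z)) MeasureTheory.volume c d :=
    fun c d => hcont.intervalIntegrable c d
  have hball : ∀ t, (dist (φ t z) ρ₁ < r ∨ dist (φ t z) ρ₂ < r) → χ (φ t z) = 0 := by
    intro t ht
    by_contra hne
    obtain ⟨-, h2, h3⟩ := hs _ hne
    rcases ht with ht | ht <;> linarith
  let V₁ := {t | dist (φ t z) ρ₁ < s}
  let V₂ := {t | dist (φ t z) ρ₂ < s}
  have hV₁ : ∀ c d, c ∈ V₁ → d ∈ V₁ → ∀ u, c ≤ u → u ≤ d → χ (φ u z) = 0 :=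
    fun c d hc hd u h2 h3 => hball u (Or.inl ((H z hz1 c d (h2.trans h3)).1 hc hd u h2 h3))
  have hV₂ : ∀ c d, c ∈ V₂ → d ∈ V₂ → ∀ u, c ≤ u → u ≤ d → χ (φ u z) = 0 :=
    fun c d hc hd u h2 h3 => hball u (Or.inr ((H z hz1 c d (h2.trans h3)).2.1 hc hd u h2 h3))
  have gap : ∀ a b, a ≤ b → (∀ t, a < t → t < b → t ∉ V₁) → (∀ t, a < t → t < b → t ∉ V₂) →
      ∫ t in a..b, χ (φ t z) ≤ 2 * T := by
    intro a b hab n1 n2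
    refine integral_window _ hcont (fun _ => h0 _) (fun _ => h1 _) a b T T1.le hab ?_
    intro t t' hat htt htb hgt hgt'
    by_contra hlt
    push Not at hlt
    obtain ⟨u, hu0, huT, hu⟩ := HT (φ t z) (by rw [h.p_inv]; exact hz2) (fun u hu hu' => by
      rw [← h.add]
      exact h.d0 z (hz1.trans d2) t (u + t) t' (by linarith) (by linarith) (hs _ hgt).1 (hs _ hgt').1)
    rw [← h.add] at hu
    have hu' : χ (φ (u + t) z) = 0 := hball _ (hu.imp (fun x => x.trans_le s2) fun x => x.trans_le s2)
    have hupos : 0 < u := by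
      rcases hu0.lt_or_eq with h | h
      · exact h
      · rw [← h, zero_add] at hu'; exact absurd hu' hgt
    rcases hu with hu | hu
    · exact n1 (u + t) (by linarith) (by linarith) hu
    · exact n2 (u + t) (by linarith) (by linarith) hu
  have gap2 : ∀ a b, a ≤ b → (∀ t, a < t → t < b → t ∉ V₁) → ∫ t in a..b, χ (φ t z) ≤ 4 * T := by
    intro a b hab n1
    obtain ⟨c, d, hac, hcd, hdb, m1, m2, m3⟩ := hull_split (fun t => χ (φ t z)) V₂ hV₂ a b hab
    rw [← intervalIntegral.integral_add_adjacent_intervals (hIntg a c) (hIntg c b),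
      ← intervalIntegral.integral_add_adjacent_intervals (hIntg c d) (hIntg d b), m3]
    have e1 := gap a c hac (fun t h1 h2 => n1 t h1 (by linarith)) m1
    have e2 := gap d b hdb (fun t h1 h2 => n1 t (by linarith) h2) m2
    linarith
  obtain ⟨c, d, hac, hcd, hdb, m1, m2, m3⟩ := hull_split (fun t => χ (φ t z)) V₁ hV₁ a b hab
  rw [← intervalIntegral.integral_add_adjacent_intervals (hIntg a c) (hIntg c b),
      ← intervalIntegral.integral_add_adjacent_intervals (hIntg c d) (hIntg d b), m3]
  have e1 := gap2 a c hac m1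
  have e2 := gap2 d b hdb m2
  linarith

end Dyn


theorem exists_tent {E : Type*} [PseudoMetricSpace E] (ρ : E) (s : ℝ) (hs : 0 < s) :
    ∃ β : E → ℝ, (∀ z, 0 ≤ β z) ∧ (∀ z, β z ≤ 1) ∧ (∀ z, dist z ρ < s → β z = 1) ∧
      (∀ z, β z ≠ 0 → dist z ρ < 2 * s) ∧ ∃ L, 0 ≤ L ∧ ∀ z w, |β z - β w| ≤ L * dist z w := by
  refine ⟨fun z => max 0 (min 1 (2 - dist z ρ / s)), fun z => le_max_left _ _,
    fun z => max_le zero_le_one (min_le_left _ _), ?_, ?_, s⁻¹, by positivity, ?_⟩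
  · intro z hz
    have : dist z ρ / s < 1 := (div_lt_one hs).2 hz
    simp only
    rw [min_eq_left (by linarith), max_eq_right zero_le_one]
  · intro z hz
    by_contra hc
    push Not at hc
    apply hz
    have : 2 ≤ dist z ρ / s := (le_div_iff₀ hs).2 hc
    apply max_eq_left
    exact (min_le_right _ _).trans (by linarith)
  · intro z w
    refine (abs_max_sub_max_le_max _ _ _ _).trans ?_
    rw [sub_self, abs_zero, max_eq_right (abs_nonneg _)]
    refine (abs_min_sub_min_le_max _ _ _ _).trans ?_
    rw [sub_self, abs_zero, max_eq_right (abs_nonneg _)]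
    have : 2 - dist z ρ / s - (2 - dist w ρ / s) = s⁻¹ * (dist w ρ - dist z ρ) := by
      field_simp; ring
    rw [this, abs_mul, abs_of_pos (inv_pos.2 hs), dist_comm z w]
    exact mul_le_mul_of_nonneg_left (abs_dist_sub_le w z ρ) (by positivity)

namespace Dyn
variable {E : Type*} [NormedAddCommGroup E] {K : NNReal} {φ : ℝ → E → E}
    {p q : E → ℝ} {R E₀ δ₀ : ℝ} {ρ₁ ρ₂ : E}

theorem value_aux (h : Dyn K φ p q R E₀ δ₀ ρ₁ ρ₂) (χ b : E → ℝ) (L Lb C : ℝ) (hL : 0 ≤ L) (hLb : 0 ≤ Lb)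
    (hχ : ∀ z w, |χ z - χ w| ≤ L * dist z w) (hχ0 : ∀ z, 0 ≤ χ z)
    (hb : ∀ z w, |b z - b w| ≤ Lb * dist z w) (hb0 : ∀ z, 0 ≤ b z)
    (hC0 : 0 ≤ C)
    (hC : ∀ z t, 0 ≤ t → b (φ (-t) z) + ∫ u in (-t)..0, χ (φ u z) ≤ C)
    (η : ℝ) (hη : 0 < η) :
    ∃ (f : E → ℝ) (Lf : ℝ), 0 ≤ Lf ∧ (∀ z w, |f z - f w| ≤ Lf * dist z w) ∧
      (∀ z, 0 ≤ f z) ∧ (∀ z, f z ≤ C) ∧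
      (∀ z τ, 0 ≤ τ → f z + (∫ u in (0:ℝ)..τ, χ (φ u z)) - η * τ ≤ f (φ τ z)) ∧
      (∀ z c, (∀ t, 0 ≤ t → b (φ (-t) z) + ∫ u in (-t)..0, χ (φ u z) ≤ c) → f z ≤ c) ∧
      (∀ z, b z ≤ f z) := by
  set T := C / η with hT
  have hT0 : 0 ≤ T := by positivity
  have hχc : Continuous χ := by
    have : LipschitzWith ⟨L, hL⟩ χ := LipschitzWith.of_dist_le_mul (fun z w => by rw [Real.dist_eq]; exact hχ z w)
    exact this.continuous
  have hIntg : ∀ z c d, IntervalIntegrable (fun t => χ (φ t z)) MeasureTheory.volume c d :=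
    fun z c d => (hχc.comp (h.cont z)).intervalIntegrable c d
  let Φ : E → Set.Icc (0:ℝ) T → ℝ := fun z t => b (φ (-t) z) + (∫ u in (-(t:ℝ))..0, χ (φ u z)) - η * t
  haveI : Nonempty (Set.Icc (0:ℝ) T) := ⟨⟨0, le_rfl, hT0⟩⟩
  have hΦC : ∀ z t, Φ z t ≤ C := fun z t => by
    have h1 := hC z t t.2.1
    have h2 : 0 ≤ η * t := mul_nonneg hη.le t.2.1
    simp only [Φ]; linarith
  have hbdd : ∀ z, BddAbove (Set.range (Φ z)) := fun z => ⟨C, by rintro _ ⟨t, rfl⟩; exact hΦC z t⟩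
  have hpos : ∀ z, b z ≤ ⨆ t, Φ z t := fun z => by
    have := le_ciSup (hbdd z) ⟨0, le_rfl, hT0⟩
    simp only [Φ, neg_zero, intervalIntegral.integral_same, h.zero] at this
    linarith
  have hMp : 0 ≤ (Lb + T * L) * Real.exp (K * T) := by positivity
  have hΦL : ∀ z w t, Φ z t - Φ w t ≤ (Lb + T * L) * Real.exp (K * T) * dist z w := by
    intro z w t
    have hexp : ∀ u, |u| ≤ T → dist (φ u z) (φ u w) ≤ Real.exp (K * T) * dist z w := fun u hu =>
      (h.lip u z w).trans (mul_le_mul_of_nonneg_right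
        (Real.exp_le_exp.2 (mul_le_mul_of_nonneg_left hu K.2)) dist_nonneg)
    have h1 : b (φ (-t) z) - b (φ (-t) w) ≤ Lb * (Real.exp (K * T) * dist z w) :=
      (le_abs_self _).trans ((hb _ _).trans (mul_le_mul_of_nonneg_left
        (hexp _ (by rw [abs_neg, abs_of_nonneg t.2.1]; exact t.2.2)) hLb))
    have h2 : (∫ u in (-(t:ℝ))..0, χ (φ u z)) - (∫ u in (-(t:ℝ))..0, χ (φ u w)) ≤
        T * (L * (Real.exp (K * T) * dist z w)) := by
      rw [← intervalIntegral.integral_sub (hIntg z _ _) (hIntg w _ _)]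
      have hneg : -(t:ℝ) ≤ 0 := by linarith [t.2.1]
      have : ∫ u in (-(t:ℝ))..0, (χ (φ u z) - χ (φ u w)) ≤ ∫ u in (-(t:ℝ))..0, (L * (Real.exp (K * T) * dist z w)) := by
        apply intervalIntegral.integral_mono_on hneg
        · exact (hIntg z _ _).sub (hIntg w _ _)
        · exact intervalIntegrable_const
        · intro u hu
          refine (le_abs_self _).trans ((hχ _ _).trans (mul_le_mul_of_nonneg_left (hexp _ ?_) hL))
          rw [abs_of_nonpos hu.2]
          linarith [hu.1, t.2.2]
      refine this.trans ?_
      rw [intervalIntegral.integral_const, smul_eq_mul]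
      apply mul_le_mul_of_nonneg_right
      · linarith [t.2.2]
      · positivity
    simp only [Φ]
    calc _ = (b (φ (-t) z) - b (φ (-t) w)) + ((∫ u in (-(t:ℝ))..0, χ (φ u z)) - (∫ u in (-(t:ℝ))..0, χ (φ u w))) := by ring
      _ ≤ _ := add_le_add h1 h2
      _ = _ := by ring
  have hL1 : ∀ z w, (⨆ t, Φ z t) - (⨆ t, Φ w t) ≤ (Lb + T * L) * Real.exp (K * T) * dist z w := by
    intro z w
    rw [sub_le_iff_le_add]
    apply ciSup_le
    intro t
    have h1 := hΦL z w t
    have h2 := le_ciSup (hbdd w) t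
    linarith
  refine ⟨fun z => ⨆ t, Φ z t, _, hMp, ?_, fun z => (hb0 z).trans (hpos z),
    fun z => ciSup_le (hΦC z), ?_, ?_, hpos⟩
  · intro z w
    rw [abs_le]
    have h1 := hL1 z w
    have h2 := hL1 w z
    rw [dist_comm w z] at h2
    exact ⟨by linarith, h1⟩
  · intro z τ hτ
    have key : ∀ t, Φ z t ≤ (⨆ t, Φ (φ τ z) t) - (∫ u in (0:ℝ)..τ, χ (φ u z)) + η * τ := by
      intro t
      have hshift : ∫ u in (-((t:ℝ) + τ))..0, χ (φ u (φ τ z)) = ∫ u in (-(t:ℝ))..τ, χ (φ u z) := by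
        simp only [← h.add]
        rw [intervalIntegral.integral_comp_add_right (fun u => χ (φ u z)) τ]
        congr 1 <;> ring
      have hpt : φ (-((t:ℝ) + τ)) (φ τ z) = φ (-t) z := by
        rw [← h.add]; congr 1; ring
      have hsplit : ∫ u in (-(t:ℝ))..τ, χ (φ u z) = (∫ u in (-(t:ℝ))..0, χ (φ u z)) + ∫ u in (0:ℝ)..τ, χ (φ u z) :=
        (intervalIntegral.integral_add_adjacent_intervals (hIntg z _ _) (hIntg z _ _)).symm
      by_cases hle : (t:ℝ) + τ ≤ T
      · have h1 := le_ciSup (hbdd (φ τ z)) ⟨(t:ℝ) + τ, add_nonneg t.2.1 hτ, hle⟩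
        simp only [Φ, hshift, hpt, hsplit] at h1 ⊢
        linarith
      · push Not at hle
        have h1 := hC (φ τ z) ((t:ℝ) + τ) (add_nonneg t.2.1 hτ)
        rw [hshift, hpt, hsplit] at h1
        have h2 := (hb0 (φ τ z)).trans (hpos (φ τ z))
        have h3 : C ≤ η * (t + τ) := by
          have : η * T = C := by rw [hT]; field_simp
          rw [← this]
          exact mul_le_mul_of_nonneg_left hle.le hη.le
        simp only [Φ] at h2 ⊢
        linarith
    have := ciSup_le key
    simp only
    linarith
  · intro z c hc
    apply ciSup_le
    intro t
    have h1 := hc t t.2.1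
    have h2 : 0 ≤ η * t := mul_nonneg hη.le t.2.1
    simp only [Φ]; linarith

theorem exists_value (h : Dyn K φ p q R E₀ δ₀ ρ₁ ρ₂) (r : ℝ) (hr : 0 < r) (hr' : 2 * r < dist ρ₁ ρ₂) :
    ∃ δ s : ℝ, 0 < δ ∧ δ ≤ δ₀ ∧ 0 < s ∧ s ≤ r ∧
      ∀ (χ : E → ℝ) (L : ℝ), 0 ≤ L → (∀ z w, |χ z - χ w| ≤ L * dist z w) → (∀ z, 0 ≤ χ z) →
        (∀ z, χ z ≤ 1) →
        (∀ z, χ z ≠ 0 → q z ≤ R ∧ |p z - E₀| ≤ δ ∧ r ≤ dist z ρ₁ ∧ r ≤ dist z ρ₂) →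
        ∃ C, 0 ≤ C ∧ ∀ η, 0 < η → ∃ (f : E → ℝ) (Lf : ℝ), 0 ≤ Lf ∧
          (∀ z w, |f z - f w| ≤ Lf * dist z w) ∧ (∀ z, 0 ≤ f z) ∧ (∀ z, f z ≤ C) ∧
          (∀ z τ, 0 ≤ τ → f z + (∫ u in (0:ℝ)..τ, χ (φ u z)) - η * τ ≤ f (φ τ z)) ∧
          (∃ c, ∀ z, dist z ρ₁ < s → f z = c) ∧ (∃ c, ∀ z, dist z ρ₂ < s → f z = c) := by
  obtain ⟨δ, s₀, T, hδ, hδ', hs₀, hs₀r, hT, HR, HT⟩ := h.time_bound r hr hr'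
  have hopen : IsOpen {z | |p z - E₀| < δ} :=
    isOpen_lt ((h.p_cont.sub continuous_const).abs) continuous_const
  obtain ⟨s₁, hs₁, hb₁⟩ := Metric.isOpen_iff.1 hopen ρ₁ (by simp [h.e₁, hδ])
  obtain ⟨s₂, hs₂, hb₂⟩ := Metric.isOpen_iff.1 hopen ρ₂ (by simp [h.e₂, hδ])
  set s := min s₀ (min s₁ s₂) / 2 with hs
  have hsp : 0 < s := by positivity
  have hss : 2 * s ≤ s₀ := by rw [hs]; linarith [min_le_left s₀ (min s₁ s₂)]
  have hss1 : 2 * s ≤ s₁ := by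
    rw [hs]; linarith [(min_le_right s₀ (min s₁ s₂)).trans (min_le_left _ _)]
  have hss2 : 2 * s ≤ s₂ := by
    rw [hs]; linarith [(min_le_right s₀ (min s₁ s₂)).trans (min_le_right _ _)]
  refine ⟨δ, s, hδ, hδ', hsp, by linarith, ?_⟩
  intro χ L hL hχ hχ0 hχ1 hsupp
  obtain ⟨β₁, p0, p1, pe, ps, L₁, hL₁, pL⟩ := exists_tent ρ₁ s hsp
  obtain ⟨β₂, q0, q1, qe, qs, L₂, hL₂, qL⟩ := exists_tent ρ₂ s hsp
  have hχc : Continuous χ := by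
    have : LipschitzWith ⟨L, hL⟩ χ := LipschitzWith.of_dist_le_mul (fun z w => by rw [Real.dist_eq]; exact hχ z w)
    exact this.continuous
  have HT' := HT χ hχc hχ0 hχ1 (fun z hz => ⟨(hsupp z hz).1, (hsupp z hz).2.2⟩)
  set b : E → ℝ := fun z => T * β₁ z + 2 * T * β₂ z with hbdef
  -- disjointness
  have hdisj : ∀ z, dist z ρ₁ < s₀ → dist z ρ₂ < s₀ → False := fun z h1 h2 => by
    have := dist_triangle_left ρ₁ ρ₂ z
    linarith
  have hb1 : ∀ z, dist z ρ₁ < s₀ → b z ≤ T := fun z hz => by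
    have : β₂ z = 0 := by
      by_contra hne
      exact hdisj z hz ((qs z hne).trans_le hss)
    simp only [hbdef, this]
    nlinarith [p1 z]
  have hb2 : ∀ z, b z ≤ 2 * T := fun z => by
    by_cases hz : β₂ z = 0
    · simp only [hbdef, hz]
      nlinarith [p1 z]
    · have : β₁ z = 0 := by
        by_contra hne
        exact hdisj z ((ps z hne).trans_le hss) ((qs z hz).trans_le hss)
      simp only [hbdef, this]
      nlinarith [q1 z]
  have hb3 : ∀ z, ¬ dist z ρ₁ < s₀ → ¬ dist z ρ₂ < s₀ → b z = 0 := fun z h1 h2 => by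
    have e1 : β₁ z = 0 := by
      by_contra hne; exact h1 ((ps z hne).trans_le hss)
    have e2 : β₂ z = 0 := by
      by_contra hne; exact h2 ((qs z hne).trans_le hss)
    simp [hbdef, e1, e2]
  have hb0 : ∀ z, 0 ≤ b z := fun z => by
    have := p0 z; have := q0 z; simp only [hbdef]; positivity
  have hbL : ∀ z w, |b z - b w| ≤ (T * L₁ + 2 * T * L₂) * dist z w := by
    intro z w
    have : b z - b w = T * (β₁ z - β₁ w) + 2 * T * (β₂ z - β₂ w) := by simp only [hbdef]; ring
    rw [this]
    refine (abs_add_le _ _).trans ?_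
    rw [abs_mul, abs_mul, abs_of_nonneg hT, abs_of_nonneg (show 0 ≤ 2 * T by positivity)]
    have e1 := mul_le_mul_of_nonneg_left (pL z w) hT
    have e2 := mul_le_mul_of_nonneg_left (qL z w) (show 0 ≤ 2 * T by positivity)
    linarith
  have hbE : ∀ z, ¬ |p z - E₀| ≤ δ → b z = 0 := by
    intro z hz
    have e1 : β₁ z = 0 := by
      by_contra hne
      exact hz (hb₁ (show z ∈ Metric.ball ρ₁ s₁ from (ps z hne).trans_le hss1)).le
    have e2 : β₂ z = 0 := by
      by_contra hne
      exact hz (hb₂ (show z ∈ Metric.ball ρ₂ s₂ from (qs z hne).trans_le hss2)).le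
    simp [hbdef, e1, e2]
  have hall : ∀ z t, 0 ≤ t → b (φ (-t) z) + ∫ u in (-t)..0, χ (φ u z) ≤ 3 * T := by
    intro z t ht
    by_cases hz : |p z - E₀| ≤ δ
    · have e1 := hb2 (φ (-t) z)
      have e2 := HT' z hz (-t) 0 (by linarith)
      linarith
    · rw [hbE _ (by rw [h.p_inv]; exact hz)]
      have : ∀ u, χ (φ u z) = 0 := fun u => by
        by_contra hne
        have := (hsupp _ hne).2.1
        rw [h.p_inv] at this
        exact hz this
      simp only [this]
      simp
      exact hT
  refine ⟨3 * T, by positivity, fun η hη => ?_⟩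
  obtain ⟨f, Lf, f1, f2, f3, f4, f5, f6, f7⟩ := h.value_aux χ b L (T * L₁ + 2 * T * L₂) (3 * T) hL (by positivity) hχ hχ0
    hbL hb0 (by positivity) hall η hη
  refine ⟨f, Lf, f1, f2, f3, f4, f5, ⟨T, fun z hz => ?_⟩, ⟨2 * T, fun z hz => ?_⟩⟩
  · apply le_antisymm
    · apply f6
      intro t ht
      have hzb : |p z - E₀| ≤ δ := (hb₁ (show z ∈ Metric.ball ρ₁ s₁ from hz.trans_le (by linarith))).le
      have e2 := HT' z hzb (-t) 0 (by linarith)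
      have hz0 : dist (φ 0 z) ρ₁ < s₀ := by rw [h.zero]; linarith
      by_cases c1 : dist (φ (-t) z) ρ₁ < s₀
      · have := (HR z hzb (-t) 0 (by linarith)).1 c1 hz0
        have h0 : ∫ u in (-t)..0, χ (φ u z) = 0 := by
          rw [intervalIntegral.integral_congr (g := fun _ => (0:ℝ))]
          · simp
          · intro u hu
            rw [Set.uIcc_of_le (by linarith)] at hu
            by_contra hne
            have h1 := this u hu.1 hu.2
            have h2 := (hsupp _ hne).2.2.1
            linarith
        rw [h0]
        linarith [hb1 _ c1]
      · by_cases c2 : dist (φ (-t) z) ρ₂ < s₀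
        · exact absurd ⟨c2, hz0⟩ (HR z hzb (-t) 0 (by linarith)).2.2
        · rw [hb3 _ c1 c2]; linarith
    · refine le_trans ?_ (f7 z)
      simp only [hbdef, pe z hz]
      have := q0 z
      have : 0 ≤ 2 * T * β₂ z := by positivity
      linarith
  · apply le_antisymm
    · apply f6
      intro t ht
      have hzb : |p z - E₀| ≤ δ := (hb₂ (show z ∈ Metric.ball ρ₂ s₂ from hz.trans_le (by linarith))).le
      have e2 := HT' z hzb (-t) 0 (by linarith)
      have hz0 : dist (φ 0 z) ρ₂ < s₀ := by rw [h.zero]; linarith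
      by_cases c1 : dist (φ (-t) z) ρ₂ < s₀
      · have := (HR z hzb (-t) 0 (by linarith)).2.1 c1 hz0
        have h0 : ∫ u in (-t)..0, χ (φ u z) = 0 := by
          rw [intervalIntegral.integral_congr (g := fun _ => (0:ℝ))]
          · simp
          · intro u hu
            rw [Set.uIcc_of_le (by linarith)] at hu
            by_contra hne
            have h1 := this u hu.1 hu.2
            have h2 := (hsupp _ hne).2.2.2
            linarith
        rw [h0]
        linarith [hb2 (φ (-t) z)]
      · by_cases c2 : dist (φ (-t) z) ρ₁ < s₀
        · linarith [hb1 _ c2]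
        · rw [hb3 _ c2 c1]; linarith
    · refine le_trans ?_ (f7 z)
      simp only [hbdef, qe z hz]
      have := p0 z
      have : 0 ≤ T * β₁ z := by positivity
      linarith

end Dyn


theorem IsFlow.taylor {E : Type*} [NormedAddCommGroup E] [NormedSpace ℝ E]
    {v : E → E} {K : NNReal} {φ : ℝ → E → E} (h : IsFlow v K φ) (hK : LipschitzWith K v) (M : ℝ)
    (hM : ∀ x, ‖v x‖ ≤ M) (z : E) :
    (∀ τ, 0 ≤ τ → ‖φ τ z - z‖ ≤ M * τ) ∧ ∀ τ, 0 ≤ τ → ‖φ τ z - (z + τ • v z)‖ ≤ K * M * τ ^ 2 := by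
  have h1 : ∀ τ, 0 ≤ τ → ‖φ τ z - z‖ ≤ M * τ := by
    intro τ hτ
    have := norm_image_sub_le_of_norm_deriv_le_segment' (f := fun s => φ s z) (f' := fun s => v (φ s z))
      (C := M) (a := 0) (b := τ) (fun s _ => (h.deriv z s).hasDerivWithinAt) (fun s _ => hM _) τ ⟨hτ, le_rfl⟩
    simpa [h.zero] using this
  refine ⟨h1, fun τ hτ => ?_⟩
  have := norm_image_sub_le_of_norm_deriv_le_segment' (f := fun s => φ s z - s • v z)
      (f' := fun s => v (φ s z) - (1:ℝ) • v z)
      (C := K * (M * τ)) (a := 0) (b := τ)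
      (fun s _ => ((h.deriv z s).sub ((hasDerivAt_id s).smul_const (v z))).hasDerivWithinAt) (fun s hs => by
        rw [one_smul, ← dist_eq_norm]
        refine (hK.dist_le_mul _ _).trans (mul_le_mul_of_nonneg_left ?_ K.2)
        rw [dist_eq_norm]
        have hM0 : 0 ≤ M := (norm_nonneg _).trans (hM z)
        exact (h1 s hs.1).trans (mul_le_mul_of_nonneg_left hs.2.le hM0)) τ ⟨hτ, le_rfl⟩
  simp only [h.zero, zero_smul, sub_zero] at this
  calc ‖φ τ z - (z + τ • v z)‖ = ‖φ τ z - τ • v z - z‖ := by congr 1; abel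
    _ ≤ _ := this
    _ = _ := by ring

theorem smoothing {E : Type*} [NormedAddCommGroup E] [NormedSpace ℝ E] [FiniteDimensional ℝ E]
    [MeasurableSpace E] [BorelSpace E]
    {v : E → E} {K : NNReal} {φ : ℝ → E → E} (h : IsFlow v K φ) (hK : LipschitzWith K v) (M : ℝ)
    (hM : ∀ x, ‖v x‖ ≤ M) (χ f : E → ℝ) (L Lf η ε : ℝ) (hL : 0 ≤ L) (hLf : 0 ≤ Lf) (hε : 0 < ε)
    (hχ : ∀ z w, |χ z - χ w| ≤ L * dist z w)
    (hf : ∀ z w, |f z - f w| ≤ Lf * dist z w)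
    (hv : ∀ z τ, 0 ≤ τ → f z + (∫ u in (0:ℝ)..τ, χ (φ u z)) - η * τ ≤ f (φ τ z)) :
    ∃ g : E → ℝ, ContDiff ℝ (⊤ : ℕ∞) g ∧ (∀ x, χ x - η - ε ≤ fderiv ℝ g x (v x)) ∧
      (∀ x, |g x - f x| ≤ ε) ∧
      ∀ x c, (∀ y, dist y x < ε → f y = c) → g x = c := by
  classical
  set μ : MeasureTheory.Measure E := MeasureTheory.Measure.addHaar
  set D := L + Lf * K + Lf + 1 with hD
  have hDp : 1 ≤ D := by
    have : 0 ≤ Lf * K := by positivity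
    linarith
  set σ := ε / D with hσ
  have hσp : 0 < σ := by positivity
  have hσε : D * σ = ε := by rw [hσ]; field_simp
  have hσle : σ ≤ ε := by nlinarith
  let k : ContDiffBump (0:E) := ⟨σ / 2, σ, by positivity, by linarith⟩
  have hfc : Continuous f := by
    have : LipschitzWith ⟨Lf, hLf⟩ f := LipschitzWith.of_dist_le_mul (fun z w => by rw [Real.dist_eq]; exact hf z w)
    exact this.continuous
  have hχc : Continuous χ := by
    have : LipschitzWith ⟨L, hL⟩ χ := LipschitzWith.of_dist_le_mul (fun z w => by rw [Real.dist_eq]; exact hχ z w)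
    exact this.continuous
  set g : E → ℝ := MeasureTheory.convolution (k.normed μ) f (ContinuousLinearMap.lsmul ℝ ℝ) μ with hg
  have hgs : ContDiff ℝ (⊤ : ℕ∞) g :=
    k.hasCompactSupport_normed.contDiff_convolution_left _ k.contDiff_normed hfc.locallyIntegrable
  have hgx : ∀ x, g x = ∫ y, k.normed μ y * f (x - y) ∂μ := fun x => rfl
  have hIntg : ∀ x, MeasureTheory.Integrable (fun y => k.normed μ y * f (x - y)) μ := fun x =>
    (k.continuous_normed.mul (hfc.comp (continuous_const.sub continuous_id))).integrable_of_hasCompactSupport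
      (k.hasCompactSupport_normed.mul_right)
  have hM0 : 0 ≤ M := (norm_nonneg _).trans (hM 0)
  refine ⟨g, hgs, ?_, ?_, ?_⟩
  · intro x
    -- pointwise inequality
    have hpt : ∀ τ, 0 ≤ τ → ∀ y, ‖y‖ ≤ σ →
        τ * (χ x - η - ε) - (L * M + Lf * (K * M)) * τ ^ 2 ≤ f (x + τ • v x - y) - f (x - y) := by
      intro τ hτ y hy
      set z := x - y with hz
      have hxz : dist x z ≤ σ := by rw [dist_eq_norm, hz]; simpa using hy
      obtain ⟨t1, t2⟩ := h.taylor hK M hM z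
      have a1 : f (φ τ z) - Lf * (K * M * τ ^ 2 + τ * (K * σ)) ≤ f (x + τ • v x - y) := by
        have e1 := (le_abs_self _).trans (hf (φ τ z) (x + τ • v x - y))
        have e2 : dist (φ τ z) (x + τ • v x - y) ≤ K * M * τ ^ 2 + τ * (K * σ) := by
          have : x + τ • v x - y = z + τ • v x := by rw [hz]; abel
          rw [this]
          refine (dist_triangle _ (z + τ • v z) _).trans (add_le_add ?_ ?_)
          · rw [dist_eq_norm]; exact t2 τ hτ
          · rw [dist_add_left, dist_smul₀, Real.norm_of_nonneg hτ]
            refine mul_le_mul_of_nonneg_left ((hK.dist_le_mul _ _).trans ?_) hτ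
            rw [dist_comm]
            exact mul_le_mul_of_nonneg_left hxz K.2
        have e3 := mul_le_mul_of_nonneg_left e2 hLf
        linarith
      have a2 := hv z τ hτ
      have a3 : τ * (χ x - L * σ) - L * M * τ ^ 2 ≤ ∫ u in (0:ℝ)..τ, χ (φ u z) := by
        have : ∫ u in (0:ℝ)..τ, (χ x - L * σ - L * (M * τ)) ≤ ∫ u in (0:ℝ)..τ, χ (φ u z) := by
          apply intervalIntegral.integral_mono_on hτ intervalIntegrable_const
          · exact (hχc.comp (h.continuous_time z)).intervalIntegrable _ _
          · intro u hu
            have e1 := (le_abs_self _).trans (hχ x (φ u z))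
            have e2 : dist x (φ u z) ≤ σ + M * τ := by
              refine (dist_triangle _ z _).trans (add_le_add hxz ?_)
              rw [dist_comm, dist_eq_norm]
              exact (t1 u hu.1).trans (mul_le_mul_of_nonneg_left hu.2 hM0)
            have e3 := mul_le_mul_of_nonneg_left e2 hL
            linarith
        rw [intervalIntegral.integral_const, smul_eq_mul] at this
        linarith
      have a4 : τ * (L * σ + Lf * K * σ) ≤ τ * ε := by
        apply mul_le_mul_of_nonneg_left _ hτ
        rw [← hσε, hD]
        nlinarith
      nlinarith
    have hin : ∀ τ, 0 ≤ τ → τ * (χ x - η - ε) - (L * M + Lf * (K * M)) * τ ^ 2 ≤ g (x + τ • v x) - g x := by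
      intro τ hτ
      rw [hgx, hgx, ← MeasureTheory.integral_sub (hIntg _) (hIntg _)]
      have : τ * (χ x - η - ε) - (L * M + Lf * (K * M)) * τ ^ 2 =
          ∫ y, k.normed μ y * (τ * (χ x - η - ε) - (L * M + Lf * (K * M)) * τ ^ 2) ∂μ := by
        rw [MeasureTheory.integral_mul_const, k.integral_normed, one_mul]
      rw [this]
      apply MeasureTheory.integral_mono
      · exact k.integrable_normed.mul_const _
      · exact (hIntg _).sub (hIntg _)
      · intro y
        simp only
        rw [← mul_sub]
        by_cases hy : ‖y‖ < σ
        · exact mul_le_mul_of_nonneg_left (hpt τ hτ y hy.le) (k.nonneg_normed y)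
        · have : k.normed μ y = 0 := by
            have hs := k.support_normed_eq (μ := μ)
            have : y ∉ Function.support (k.normed μ) := by
              rw [hs]; simpa [k] using hy
            simpa using this
          rw [this]; simp
    have hd : HasDerivAt (fun τ : ℝ => g (x + τ • v x)) (fderiv ℝ g x (v x)) 0 := by
      have h1 : HasFDerivAt g (fderiv ℝ g x) (x + (0:ℝ) • v x) := by
        rw [zero_smul, add_zero]
        exact (hgs.differentiable (by simp)).differentiableAt.hasFDerivAt
      have h2 : HasDerivAt (fun τ : ℝ => x + τ • v x) (v x) 0 := by
        simpa using ((hasDerivAt_id (0:ℝ)).smul_const (v x)).const_add x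
      exact h1.comp_hasDerivAt 0 h2
    have hsl := hd.tendsto_slope_zero_right
    have hlow : Tendsto (fun τ : ℝ => (χ x - η - ε) - (L * M + Lf * (K * M)) * τ) (nhdsWithin 0 (Set.Ioi 0))
        (nhds (χ x - η - ε)) := by
      have : Tendsto (fun τ : ℝ => (χ x - η - ε) - (L * M + Lf * (K * M)) * τ) (nhds 0)
        (nhds ((χ x - η - ε) - (L * M + Lf * (K * M)) * 0)) := by
          apply Continuous.tendsto; fun_prop
      rw [mul_zero, sub_zero] at this
      exact this.mono_left nhdsWithin_le_nhds
    refine le_of_tendsto_of_tendsto hlow hsl ?_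
    filter_upwards [self_mem_nhdsWithin] with τ hτ
    have hτ' : 0 < τ := hτ
    have := hin τ hτ'.le
    simp only [zero_add, zero_smul, add_zero, smul_eq_mul]
    rw [inv_mul_eq_div, le_div_iff₀ hτ']
    nlinarith
  · intro x
    rw [← Real.dist_eq]
    refine k.dist_normed_convolution_le hfc.aestronglyMeasurable (fun y hy => ?_)
    rw [Real.dist_eq]
    refine (hf _ _).trans ?_
    have : dist y x ≤ σ := le_of_lt hy
    have e1 := mul_le_mul_of_nonneg_left this hLf
    have : 0 ≤ Lf * K := by positivity
    nlinarith
  · intro x c hc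
    have : g x = f x := by
      apply k.normed_convolution_eq_right
      intro y hy
      have : dist y x < σ := hy
      rw [hc y (this.trans_le hσle), hc x (by rwa [dist_self])]
    rw [this, hc x (by rwa [dist_self])]


/-- The linear map sending a covector to the corresponding Hamiltonian vector. -/
noncomputable def Jlin (n : ℕ) : (((Fin n → ℝ) × (Fin n → ℝ)) →L[ℝ] ℝ) →L[ℝ] ((Fin n → ℝ) × (Fin n → ℝ)) :=
  LinearMap.toContinuousLinearMap
    { toFun := fun l => (fun i => l (0, Pi.single i 1), fun i => - l (Pi.single i 1, 0))
      map_add' := by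
        intro l m
        ext i
        · simp
        · simp; ring
      map_smul' := by
        intro c l
        ext i
        · simp
        · simp }

theorem Jlin_apply {n : ℕ} (l : ((Fin n → ℝ) × (Fin n → ℝ)) →L[ℝ] ℝ) :
    Jlin n l = (fun i => l (0, Pi.single i 1), fun i => - l (Pi.single i 1, 0)) := rfl

theorem Hvf_eq {n : ℕ} (p : (Fin n → ℝ) × (Fin n → ℝ) → ℝ) (ρ : (Fin n → ℝ) × (Fin n → ℝ)) :
    Hvf p ρ = Jlin n (fderiv ℝ p ρ) := rfl

theorem omega_Jlin {n : ℕ} (l : ((Fin n → ℝ) × (Fin n → ℝ)) →L[ℝ] ℝ) (w : (Fin n → ℝ) × (Fin n → ℝ)) :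
    stdSymplectic w (Jlin n l) = l w := by
  have hw : w = (∑ i, w.1 i • ((Pi.single i 1 : Fin n → ℝ), (0 : Fin n → ℝ))) +
      ∑ i, w.2 i • ((0 : Fin n → ℝ), (Pi.single i 1 : Fin n → ℝ)) := by
    ext j
    · simp [Prod.fst_sum, Finset.sum_apply, Pi.single_apply]
    · simp [Prod.snd_sum, Finset.sum_apply, Pi.single_apply]
  conv_rhs => rw [hw]
  rw [map_add, map_sum, map_sum]
  simp only [map_smul, smul_eq_mul, stdSymplectic, Jlin_apply]
  simp only [mul_neg, Finset.sum_neg_distrib]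
  ring

theorem omega_nondeg {n : ℕ} (w : (Fin n → ℝ) × (Fin n → ℝ)) (h : ∀ u, stdSymplectic u w = 0) : w = 0 := by
  ext j
  · have := h (0, Pi.single j 1)
    simpa [stdSymplectic, Pi.single_apply] using this
  · have := h (Pi.single j 1, 0)
    simpa [stdSymplectic, Pi.single_apply] using this

theorem omega_sub {n : ℕ} (u v w : (Fin n → ℝ) × (Fin n → ℝ)) :
    stdSymplectic u (v - w) = stdSymplectic u v - stdSymplectic u w := by
  simp only [stdSymplectic, Prod.fst_sub, Prod.snd_sub, Pi.sub_apply, mul_sub, Finset.sum_sub_distrib]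
  ring

/-- second order Taylor -/
theorem taylor_two {E : Type*} [NormedAddCommGroup E] [NormedSpace ℝ E] (p : E → ℝ) (ρ₀ : E)
    (hp : ContDiff ℝ (⊤ : ℕ∞) p) (h0 : fderiv ℝ p ρ₀ = 0) :
    (fun ρ => p ρ - p ρ₀ - (1/2) * fderiv ℝ (fderiv ℝ p) ρ₀ (ρ - ρ₀) (ρ - ρ₀)) =o[nhds ρ₀]
      fun ρ => ‖ρ - ρ₀‖ ^ 2 := by
  set B := fderiv ℝ (fderiv ℝ p) ρ₀
  have hdp : ContDiff ℝ (⊤ : ℕ∞) (fderiv ℝ p) := hp.fderiv_right (by simp)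
  have hB : HasFDerivAt (fderiv ℝ p) B ρ₀ := (hdp.differentiable (by simp)).differentiableAt.hasFDerivAt
  rw [Asymptotics.isLittleO_iff]
  intro ε hε
  have h1 := (Asymptotics.isLittleO_iff.1 hB.isLittleO) hε
  obtain ⟨d, hd, hball⟩ := Metric.eventually_nhds_iff.1 h1
  filter_upwards [Metric.ball_mem_nhds ρ₀ hd] with ρ hρ
  set w := ρ - ρ₀ with hw
  have hwd : ‖w‖ < d := by rw [hw, ← dist_eq_norm]; exact hρ
  have hder : ∀ t : ℝ, HasDerivAt (fun t : ℝ => p (ρ₀ + t • w) - (1/2) * (t^2 * B w w))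
      (fderiv ℝ p (ρ₀ + t • w) w - t * B w w) t := by
    intro t
    have e1 : HasFDerivAt p (fderiv ℝ p (ρ₀ + t • w)) (ρ₀ + t • w) :=
      (hp.differentiable (by simp)).differentiableAt.hasFDerivAt
    have e2 : HasDerivAt (fun τ : ℝ => ρ₀ + τ • w) w t := by
      simpa using ((hasDerivAt_id t).smul_const w).const_add ρ₀
    have e3 : HasDerivAt (fun t : ℝ => (1/2) * (t^2 * B w w)) (t * B w w) t := by
      have := (((hasDerivAt_pow 2 t).mul_const (B w w)).const_mul (1/2 : ℝ))
      have e : (1/2:ℝ) * (((2:ℕ):ℝ) * t ^ (2 - 1) * B w w) = t * B w w := by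
        norm_num
        ring
      rw [← e]
      exact this
    exact (e1.comp_hasDerivAt t e2).sub e3
  have := norm_image_sub_le_of_norm_deriv_le_segment_01' (C := ε * ‖w‖ ^ 2)
    (fun t _ => (hder t).hasDerivWithinAt) (fun t ht => by
      have hb := hball (y := ρ₀ + t • w) (by
        rw [dist_eq_norm, add_sub_cancel_left, norm_smul, Real.norm_of_nonneg ht.1]
        nlinarith [norm_nonneg w, ht.1, ht.2])
      rw [h0, sub_zero, add_sub_cancel_left, norm_smul, Real.norm_of_nonneg ht.1] at hb
      have e4 : fderiv ℝ p (ρ₀ + t • w) w - t * B w w = (fderiv ℝ p (ρ₀ + t • w) - B (t • w)) w := by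
        simp
      rw [e4]
      refine (ContinuousLinearMap.le_opNorm _ _).trans ?_
      calc _ ≤ (ε * (t * ‖w‖)) * ‖w‖ := mul_le_mul_of_nonneg_right hb (norm_nonneg _)
        _ = t * (ε * ‖w‖ ^ 2) := by ring
        _ ≤ 1 * (ε * ‖w‖ ^ 2) := mul_le_mul_of_nonneg_right ht.2.le (by positivity)
        _ = _ := one_mul _)
  have hend : ρ₀ + w = ρ := by rw [hw]; abel
  simp only [one_smul, zero_smul, add_zero, hend] at this
  norm_num at this ⊢
  convert this using 2
  ring

theorem hyp_second {n : ℕ} (p : (Fin n → ℝ) × (Fin n → ℝ) → ℝ) (hp : ContDiff ℝ (⊤ : ℕ∞) p)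
    (E₀ : ℝ) (ρ₀ : (Fin n → ℝ) × (Fin n → ℝ)) (h : IsHyperbolicFixedPt p E₀ ρ₀) :
    ∃ (A : ((Fin n → ℝ) × (Fin n → ℝ)) →L[ℝ] ((Fin n → ℝ) × (Fin n → ℝ))) (lam : Fin n → ℝ),
      (∀ k, 0 < lam k) ∧ (∀ u v, stdSymplectic (A u) (A v) = stdSymplectic u v) ∧
      ∀ v, fderiv ℝ (fderiv ℝ p) ρ₀ (A v) (A v) = ∑ k, lam k * (v.2 k ^ 2 - v.1 k ^ 2) := by
  obtain ⟨hH, hE, U, κ, lam, C, hU, hρU, hκ, -, -, hκρ, hsym, hlam, hnf⟩ := h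
  refine ⟨fderiv ℝ κ ρ₀, lam, hlam, hsym ρ₀ hρU, fun v => ?_⟩
  set A := fderiv ℝ κ ρ₀
  set B := fderiv ℝ (fderiv ℝ p) ρ₀ with hBdef
  have hd0 : fderiv ℝ p ρ₀ = 0 := by
    refine ContinuousLinearMap.ext fun w => ?_
    rw [← omega_Jlin, ← Hvf_eq, hH]
    simp [stdSymplectic]
  have hκd : HasFDerivAt κ A ρ₀ :=
    ((hκ.contDiffAt (hU.mem_nhds hρU)).differentiableAt (by simp)).hasFDerivAt
  have hT := taylor_two p ρ₀ hp hd0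
  -- the path
  have hpath : HasDerivAt (fun t : ℝ => κ (ρ₀ + t • v)) (A v) 0 := by
    have e1 : HasFDerivAt κ A (ρ₀ + (0:ℝ) • v) := by rwa [zero_smul, add_zero]
    have e2 : HasDerivAt (fun τ : ℝ => ρ₀ + τ • v) v 0 := by
      simpa using ((hasDerivAt_id (0:ℝ)).smul_const v).const_add ρ₀
    exact e1.comp_hasDerivAt 0 e2
  have hslope : Tendsto (fun t : ℝ => t⁻¹ • (κ (ρ₀ + t • v) - ρ₀)) (nhdsWithin 0 (Set.Ioi 0)) (nhds (A v)) := by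
    have := hpath.tendsto_slope_zero_right
    simpa [hκρ] using this
  have hκc : Tendsto (fun t : ℝ => κ (ρ₀ + t • v)) (nhdsWithin 0 (Set.Ioi 0)) (nhds ρ₀) := by
    have := hpath.continuousAt.tendsto
    simp only [zero_smul, add_zero, hκρ] at this
    exact this.mono_left nhdsWithin_le_nhds
  -- first limit
  have hlim1 : Tendsto (fun t : ℝ => (t ^ 2)⁻¹ * (p (κ (ρ₀ + t • v)) - E₀)) (nhdsWithin 0 (Set.Ioi 0))
      (nhds ((1/2) * B (A v) (A v))) := by
    have hquad : Tendsto (fun t : ℝ => (1/2) * B (t⁻¹ • (κ (ρ₀ + t • v) - ρ₀)) (t⁻¹ • (κ (ρ₀ + t • v) - ρ₀)))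
        (nhdsWithin 0 (Set.Ioi 0)) (nhds ((1/2) * B (A v) (A v))) := by
      have hc : Continuous (fun w => (1/2:ℝ) * B w w) := by fun_prop
      exact (hc.tendsto (A v)).comp hslope
    have hrem : Tendsto (fun t : ℝ => (t ^ 2)⁻¹ * (p (κ (ρ₀ + t • v)) - p ρ₀ -
        (1/2) * B (κ (ρ₀ + t • v) - ρ₀) (κ (ρ₀ + t • v) - ρ₀))) (nhdsWithin 0 (Set.Ioi 0)) (nhds 0) := by
      have h1 := hT.comp_tendsto hκc
      have h2 : (fun t : ℝ => (t ^ 2)⁻¹ * (p (κ (ρ₀ + t • v)) - p ρ₀ -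
        (1/2) * B (κ (ρ₀ + t • v) - ρ₀) (κ (ρ₀ + t • v) - ρ₀))) =o[nhdsWithin 0 (Set.Ioi 0)]
          fun t : ℝ => (t ^ 2)⁻¹ * ‖κ (ρ₀ + t • v) - ρ₀‖ ^ 2 :=
        (Asymptotics.isBigO_refl _ _).mul_isLittleO h1
      have h3 : Tendsto (fun t : ℝ => (t ^ 2)⁻¹ * ‖κ (ρ₀ + t • v) - ρ₀‖ ^ 2) (nhdsWithin 0 (Set.Ioi 0))
          (nhds (‖A v‖ ^ 2)) := by
        refine (hslope.norm.pow 2).congr fun t => ?_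
        rw [norm_smul, mul_pow, norm_inv, inv_pow, Real.norm_eq_abs, sq_abs]
      have h4 := h2.trans_isBigO (h3.isBigO_one ℝ)
      exact (Asymptotics.isLittleO_one_iff ℝ).1 h4
    have := hquad.add hrem
    rw [add_zero] at this
    refine this.congr' ?_
    filter_upwards [self_mem_nhdsWithin] with t ht
    simp only [map_smul, _root_.smul_apply, smul_eq_mul, hE]
    have : t ≠ 0 := ne_of_gt ht
    field_simp
    ring
  have hlim2 : Tendsto (fun t : ℝ => (t ^ 2)⁻¹ * (p (κ (ρ₀ + t • v)) - E₀)) (nhdsWithin 0 (Set.Ioi 0))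
      (nhds (∑ k, lam k / 2 * (v.2 k ^ 2 - v.1 k ^ 2))) := by
    rw [tendsto_iff_dist_tendsto_zero]
    have hbd : Tendsto (fun t : ℝ => C * (t * ‖v‖ ^ 3)) (nhdsWithin 0 (Set.Ioi 0)) (nhds 0) := by
      have : Tendsto (fun t : ℝ => C * (t * ‖v‖ ^ 3)) (nhds 0) (nhds (C * (0 * ‖v‖ ^ 3))) := by
        apply Continuous.tendsto; fun_prop
      rw [zero_mul, mul_zero] at this
      exact this.mono_left nhdsWithin_le_nhds
    refine squeeze_zero' (Eventually.of_forall fun _ => dist_nonneg) ?_ hbd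
    have hmem : ∀ᶠ t : ℝ in nhdsWithin 0 (Set.Ioi 0), ρ₀ + t • v ∈ U := by
      have : Tendsto (fun t : ℝ => ρ₀ + t • v) (nhds 0) (nhds (ρ₀ + (0:ℝ) • v)) := by
        apply Continuous.tendsto; fun_prop
      rw [zero_smul, add_zero] at this
      exact (this.mono_left nhdsWithin_le_nhds).eventually (hU.mem_nhds hρU)
    filter_upwards [hmem, self_mem_nhdsWithin] with t htU ht
    have ht' : 0 < t := ht
    have hb := hnf _ htU
    have e1 : ∑ k, lam k / 2 * (((ρ₀ + t • v).2 k - ρ₀.2 k) ^ 2 - ((ρ₀ + t • v).1 k - ρ₀.1 k) ^ 2) =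
        t ^ 2 * ∑ k, lam k / 2 * (v.2 k ^ 2 - v.1 k ^ 2) := by
      rw [Finset.mul_sum]
      apply Finset.sum_congr rfl
      intro k _
      simp
      ring
    rw [e1, add_sub_cancel_left, norm_smul, Real.norm_of_nonneg ht'.le] at hb
    rw [Real.dist_eq]
    have e2 : (t ^ 2)⁻¹ * (p (κ (ρ₀ + t • v)) - E₀) - ∑ k, lam k / 2 * (v.2 k ^ 2 - v.1 k ^ 2) =
        (t ^ 2)⁻¹ * (p (κ (ρ₀ + t • v)) - (E₀ + t ^ 2 * ∑ k, lam k / 2 * (v.2 k ^ 2 - v.1 k ^ 2))) := by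
      field_simp; ring
    rw [e2, abs_mul, abs_of_pos (by positivity)]
    calc _ ≤ (t ^ 2)⁻¹ * (C * (t * ‖v‖) ^ 3) := mul_le_mul_of_nonneg_left hb (by positivity)
      _ = _ := by field_simp
  have := tendsto_nhds_unique hlim1 hlim2
  have e3 : ∑ k, lam k / 2 * (v.2 k ^ 2 - v.1 k ^ 2) = (1/2) * ∑ k, lam k * (v.2 k ^ 2 - v.1 k ^ 2) := by
    rw [Finset.mul_sum]
    apply Finset.sum_congr rfl
    intro k _; ring
  rw [e3] at this
  linarith

theorem hyp_linear {n : ℕ} (p : (Fin n → ℝ) × (Fin n → ℝ) → ℝ) (hp : ContDiff ℝ (⊤ : ℕ∞) p)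
    (E₀ : ℝ) (ρ₀ : (Fin n → ℝ) × (Fin n → ℝ)) (h : IsHyperbolicFixedPt p E₀ ρ₀) :
    ∃ (A : ((Fin n → ℝ) × (Fin n → ℝ)) ≃L[ℝ] ((Fin n → ℝ) × (Fin n → ℝ))) (lam : Fin n → ℝ),
      (∀ k, 0 < lam k) ∧ ∃ D : ((Fin n → ℝ) × (Fin n → ℝ)) →L[ℝ] ((Fin n → ℝ) × (Fin n → ℝ)),
        HasFDerivAt (Hvf p) D ρ₀ ∧ ∀ v, D (A v) = A (fun k => lam k * v.2 k, fun k => lam k * v.1 k) := by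
  obtain ⟨A, lam, hlam, hsym, hB⟩ := hyp_second p hp E₀ ρ₀ h
  have hinj : Function.Injective A.toLinearMap := by
    rw [← LinearMap.ker_eq_bot, LinearMap.ker_eq_bot']
    intro w hw
    have hw' : A w = 0 := hw
    apply omega_nondeg
    intro u
    rw [← hsym, hw']
    simp [stdSymplectic]
  let A' := (LinearEquiv.ofInjectiveEndo A.toLinearMap hinj).toContinuousLinearEquiv
  have hA' : ∀ v, A' v = A v := fun v => rfl
  refine ⟨A', lam, hlam, (Jlin n).comp (fderiv ℝ (fderiv ℝ p) ρ₀), ?_, ?_⟩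
  · have hdp : ContDiff ℝ (⊤ : ℕ∞) (fderiv ℝ p) := hp.fderiv_right (by simp)
    exact (Jlin n).hasFDerivAt.comp ρ₀ (hdp.differentiable (by simp)).differentiableAt.hasFDerivAt
  · set B := fderiv ℝ (fderiv ℝ p) ρ₀ with hBdef
    have hsymm : ∀ u v, B u v = B v u := by
      have : IsSymmSndFDerivAt ℝ p ρ₀ := hp.contDiffAt.isSymmSndFDerivAt (by simp only [minSmoothness_of_isRCLikeNormedField]; exact WithTop.coe_le_coe.2 (le_top : (2 : ℕ∞) ≤ ⊤))
      intro u v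
      exact this u v
    have hpol : ∀ u v, B (A v) (A u) = ∑ k, lam k * (u.2 k * v.2 k - u.1 k * v.1 k) := by
      intro u v
      have e1 := hB (u + v)
      have e2 := hB u
      have e3 := hB v
      simp only [map_add, _root_.add_apply] at e1
      rw [hsymm (A u) (A v)] at e1
      have : ∑ k, lam k * ((u + v).2 k ^ 2 - (u + v).1 k ^ 2) =
          ∑ k, lam k * (u.2 k ^ 2 - u.1 k ^ 2) + ∑ k, lam k * (v.2 k ^ 2 - v.1 k ^ 2) +
          2 * ∑ k, lam k * (u.2 k * v.2 k - u.1 k * v.1 k) := by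
        rw [Finset.mul_sum, ← Finset.sum_add_distrib, ← Finset.sum_add_distrib]
        apply Finset.sum_congr rfl
        intro k _
        simp; ring
      linarith
    intro v
    rw [← sub_eq_zero]
    apply omega_nondeg
    intro u'
    obtain ⟨u, rfl⟩ := A'.surjective u'
    rw [omega_sub, hA', hA', hA', hsym]
    show stdSymplectic (A u) (Jlin n (B (A v))) - _ = 0
    rw [omega_Jlin, hpol]
    simp only [stdSymplectic]
    rw [← Finset.sum_sub_distrib, ← Finset.sum_sub_distrib]
    apply Finset.sum_eq_zero
    intro k _
    ring

theorem sum_mul_bound {n : ℕ} (u w : (Fin n → ℝ) × (Fin n → ℝ)) :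
    |∑ i, (u.1 i * w.2 i + u.2 i * w.1 i)| ≤ 2 * n * (‖u‖ * ‖w‖) := by
  refine (Finset.abs_sum_le_sum_abs _ _).trans ?_
  have : ∀ i ∈ Finset.univ, |u.1 i * w.2 i + u.2 i * w.1 i| ≤ 2 * (‖u‖ * ‖w‖) := by
    intro i _
    have a1 : |u.1 i| ≤ ‖u‖ := (norm_le_pi_norm u.1 i).trans (norm_fst_le u)
    have a2 : |u.2 i| ≤ ‖u‖ := (norm_le_pi_norm u.2 i).trans (norm_snd_le u)
    have a3 : |w.1 i| ≤ ‖w‖ := (norm_le_pi_norm w.1 i).trans (norm_fst_le w)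
    have a4 : |w.2 i| ≤ ‖w‖ := (norm_le_pi_norm w.2 i).trans (norm_snd_le w)
    refine (abs_add_le _ _).trans ?_
    rw [abs_mul, abs_mul]
    have := mul_le_mul a1 a4 (abs_nonneg _) (norm_nonneg _)
    have := mul_le_mul a2 a3 (abs_nonneg _) (norm_nonneg _)
    linarith
  refine (Finset.sum_le_sum this).trans ?_
  simp
  linarith

theorem norm_sq_le_sum {n : ℕ} (u : (Fin n → ℝ) × (Fin n → ℝ)) :
    ‖u‖ ^ 2 ≤ ∑ i, (u.1 i ^ 2 + u.2 i ^ 2) := by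
  set S := ∑ i, (u.1 i ^ 2 + u.2 i ^ 2) with hS
  have hS0 : 0 ≤ S := Finset.sum_nonneg fun i _ => by positivity
  have hi : ∀ i, u.1 i ^ 2 + u.2 i ^ 2 ≤ S := fun i =>
    Finset.single_le_sum (f := fun i => u.1 i ^ 2 + u.2 i ^ 2) (fun i _ => by positivity) (Finset.mem_univ i)
  have : ‖u‖ ≤ Real.sqrt S := by
    rw [Prod.norm_def, max_le_iff, pi_norm_le_iff_of_nonneg (Real.sqrt_nonneg _), pi_norm_le_iff_of_nonneg (Real.sqrt_nonneg _)]
    constructor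
    · intro i
      apply Real.le_sqrt_of_sq_le
      rw [Real.norm_eq_abs, sq_abs]
      linarith [hi i, sq_nonneg (u.2 i)]
    · intro i
      apply Real.le_sqrt_of_sq_le
      rw [Real.norm_eq_abs, sq_abs]
      linarith [hi i, sq_nonneg (u.1 i)]
  calc ‖u‖ ^ 2 ≤ Real.sqrt S ^ 2 := by gcongr
    _ = S := Real.sq_sqrt hS0

theorem hyp_local {n : ℕ} (p : (Fin n → ℝ) × (Fin n → ℝ) → ℝ) (hp : ContDiff ℝ (⊤ : ℕ∞) p)
    (E₀ : ℝ) (ρ₀ : (Fin n → ℝ) × (Fin n → ℝ)) (h : IsHyperbolicFixedPt p E₀ ρ₀) :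
    ∃ (Q : (Fin n → ℝ) × (Fin n → ℝ) → ℝ) (c r : ℝ), ContDiff ℝ (⊤ : ℕ∞) Q ∧ 0 < c ∧ 0 < r ∧
      ∀ ρ, dist ρ ρ₀ < r → c * dist ρ ρ₀ ^ 2 ≤ fderiv ℝ Q ρ (Hvf p ρ) := by
  obtain ⟨A, lam, hlam, D, hD, hDA⟩ := hyp_linear p hp E₀ ρ₀ h
  have hH0 : Hvf p ρ₀ = 0 := h.1
  obtain ⟨m, hm, hmle⟩ : ∃ m : ℝ, 0 < m ∧ ∀ k, m ≤ lam k := by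
    rcases isEmpty_or_nonempty (Fin n) with he | he
    · exact ⟨1, one_pos, fun k => he.elim k⟩
    · obtain ⟨k₀, hk₀⟩ := Finite.exists_min lam
      exact ⟨lam k₀, hlam k₀, hk₀⟩
  let W : ((Fin n → ℝ) × (Fin n → ℝ)) →L[ℝ] ((Fin n → ℝ) × (Fin n → ℝ)) := A.symm
  let Q : (Fin n → ℝ) × (Fin n → ℝ) → ℝ := fun ρ => ∑ i, (W (ρ - ρ₀)).1 i * (W (ρ - ρ₀)).2 i
  have hQ : ContDiff ℝ (⊤ : ℕ∞) Q := by
    apply ContDiff.sum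
    intro i _
    fun_prop
  have hQd : ∀ ρ w, fderiv ℝ Q ρ w = ∑ i, ((W (ρ - ρ₀)).1 i * (W w).2 i + (W (ρ - ρ₀)).2 i * (W w).1 i) := by
    intro ρ w
    have hWd : HasFDerivAt (fun ρ => W (ρ - ρ₀)) W ρ := by
      have := W.hasFDerivAt.comp ρ ((hasFDerivAt_id ρ).sub_const ρ₀)
      rw [ContinuousLinearMap.comp_id] at this
      exact this
    have h1 : ∀ i, HasFDerivAt (fun ρ => (W (ρ - ρ₀)).1 i)
        ((ContinuousLinearMap.proj i).comp ((ContinuousLinearMap.fst ℝ (Fin n → ℝ) (Fin n → ℝ)).comp W)) ρ := fun i =>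
      ((ContinuousLinearMap.proj (R := ℝ) (φ := fun _ : Fin n => ℝ) i).comp
        (ContinuousLinearMap.fst ℝ (Fin n → ℝ) (Fin n → ℝ))).hasFDerivAt.comp ρ hWd
    have h2 : ∀ i, HasFDerivAt (fun ρ => (W (ρ - ρ₀)).2 i)
        ((ContinuousLinearMap.proj i).comp ((ContinuousLinearMap.snd ℝ (Fin n → ℝ) (Fin n → ℝ)).comp W)) ρ := fun i =>
      ((ContinuousLinearMap.proj (R := ℝ) (φ := fun _ : Fin n => ℝ) i).comp
        (ContinuousLinearMap.snd ℝ (Fin n → ℝ) (Fin n → ℝ))).hasFDerivAt.comp ρ hWd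
    have h3 : HasFDerivAt Q _ ρ := HasFDerivAt.fun_sum (u := Finset.univ) fun i _ => (h1 i).mul (h2 i)
    rw [h3.fderiv]
    simp
  set a := ‖(A : ((Fin n → ℝ) × (Fin n → ℝ)) →L[ℝ] ((Fin n → ℝ) × (Fin n → ℝ)))‖ + 1 with ha
  have hap : 0 < a := by positivity
  set N := 2 * n * (‖W‖ * ‖W‖) + 1 with hN
  have hNp : 0 < N := by positivity
  set c := m / (2 * a ^ 2) with hc
  have hcp : 0 < c := by positivity
  have hlo := Asymptotics.isLittleO_iff.1 hD.isLittleO (show 0 < c / N by positivity)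
  obtain ⟨r, hr, hball⟩ := Metric.eventually_nhds_iff.1 hlo
  refine ⟨Q, c, r, hQ, hcp, hr, fun ρ hρ => ?_⟩
  have hb := hball hρ
  rw [hH0, sub_zero] at hb
  set y := W (ρ - ρ₀) with hy
  have hAy : A y = ρ - ρ₀ := A.apply_symm_apply _
  set e := Hvf p ρ - D (ρ - ρ₀) with he
  have hWH : W (Hvf p ρ) = (fun k => lam k * y.2 k, fun k => lam k * y.1 k) + W e := by
    have : Hvf p ρ = A (fun k => lam k * y.2 k, fun k => lam k * y.1 k) + e := by
      rw [he, ← hAy, hDA]; abel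
    rw [this, map_add]
    congr 1
    exact A.symm_apply_apply _
  rw [hQd, ← hy, hWH]
  have hsplit : ∑ i, (y.1 i * ((fun k => lam k * y.2 k, fun k => lam k * y.1 k) + W e).2 i +
      y.2 i * ((fun k => lam k * y.2 k, fun k => lam k * y.1 k) + W e).1 i) =
      (∑ i, lam i * (y.1 i ^ 2 + y.2 i ^ 2)) + ∑ i, (y.1 i * (W e).2 i + y.2 i * (W e).1 i) := by
    rw [← Finset.sum_add_distrib]
    apply Finset.sum_congr rfl
    intro i _
    simp; ring
  rw [hsplit]
  have g1 : m * ‖y‖ ^ 2 ≤ ∑ i, lam i * (y.1 i ^ 2 + y.2 i ^ 2) := by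
    refine (mul_le_mul_of_nonneg_left (norm_sq_le_sum y) hm.le).trans ?_
    rw [Finset.mul_sum]
    exact Finset.sum_le_sum fun i _ => mul_le_mul_of_nonneg_right (hmle i) (by positivity)
  have g2 : ‖ρ - ρ₀‖ ≤ a * ‖y‖ := by
    rw [← hAy]
    refine ((A : ((Fin n → ℝ) × (Fin n → ℝ)) →L[ℝ] ((Fin n → ℝ) × (Fin n → ℝ))).le_opNorm y).trans ?_
    apply mul_le_mul_of_nonneg_right _ (norm_nonneg _)
    rw [ha]; linarith
  have g3 : |∑ i, (y.1 i * (W e).2 i + y.2 i * (W e).1 i)| ≤ c * ‖ρ - ρ₀‖ ^ 2 := by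
    refine (sum_mul_bound y (W e)).trans ?_
    have e1 : ‖y‖ ≤ ‖W‖ * ‖ρ - ρ₀‖ := W.le_opNorm _
    have e2 : ‖W e‖ ≤ ‖W‖ * (c / N * ‖ρ - ρ₀‖) :=
      (W.le_opNorm _).trans (mul_le_mul_of_nonneg_left hb (norm_nonneg _))
    calc _ ≤ 2 * n * ((‖W‖ * ‖ρ - ρ₀‖) * (‖W‖ * (c / N * ‖ρ - ρ₀‖))) := by
          gcongr
      _ = (2 * n * (‖W‖ * ‖W‖)) * ((c / N) * ‖ρ - ρ₀‖ ^ 2) := by ring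
      _ ≤ N * ((c / N) * ‖ρ - ρ₀‖ ^ 2) := by
          apply mul_le_mul_of_nonneg_right _ (by positivity)
          rw [hN]; linarith
      _ = _ := by field_simp
  have g4 : 2 * c * ‖ρ - ρ₀‖ ^ 2 ≤ m * ‖y‖ ^ 2 := by
    have : ‖ρ - ρ₀‖ ^ 2 ≤ (a * ‖y‖) ^ 2 := by gcongr
    calc 2 * c * ‖ρ - ρ₀‖ ^ 2 ≤ 2 * c * (a * ‖y‖) ^ 2 := by gcongr
      _ = _ := by rw [hc]; field_simp
  rw [dist_eq_norm]
  have := neg_abs_le (∑ i, (y.1 i * (W e).2 i + y.2 i * (W e).1 i))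
  linarith


/-- squared Euclidean length of the position component -/
def qx {n : ℕ} (ρ : (Fin n → ℝ) × (Fin n → ℝ)) : ℝ := ∑ i, ρ.1 i ^ 2

/-- the generator of dilations -/
def xdot {n : ℕ} (ρ : (Fin n → ℝ) × (Fin n → ℝ)) : ℝ := ∑ i, ρ.1 i * ρ.2 i

/-- the free symbol -/
def xisq {n : ℕ} (ρ : (Fin n → ℝ) × (Fin n → ℝ)) : ℝ := ∑ i, ρ.2 i ^ 2

theorem qx_contDiff {n : ℕ} : ContDiff ℝ (⊤ : ℕ∞) (qx (n := n)) := by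
  unfold qx; fun_prop

theorem xdot_contDiff {n : ℕ} : ContDiff ℝ (⊤ : ℕ∞) (xdot (n := n)) := by
  unfold xdot; fun_prop

theorem xisq_contDiff {n : ℕ} : ContDiff ℝ (⊤ : ℕ∞) (xisq (n := n)) := by
  unfold xisq; fun_prop

theorem hasFDerivAt_fst_apply {n : ℕ} (i : Fin n) (ρ : (Fin n → ℝ) × (Fin n → ℝ)) :
    HasFDerivAt (fun ρ : (Fin n → ℝ) × (Fin n → ℝ) => ρ.1 i)
    ((ContinuousLinearMap.proj (R := ℝ) (φ := fun _ : Fin n => ℝ) i).comp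
        (ContinuousLinearMap.fst ℝ (Fin n → ℝ) (Fin n → ℝ))) ρ :=
  ((ContinuousLinearMap.proj (R := ℝ) (φ := fun _ : Fin n => ℝ) i).comp
        (ContinuousLinearMap.fst ℝ (Fin n → ℝ) (Fin n → ℝ))).hasFDerivAt

theorem hasFDerivAt_snd_apply {n : ℕ} (i : Fin n) (ρ : (Fin n → ℝ) × (Fin n → ℝ)) :
    HasFDerivAt (fun ρ : (Fin n → ℝ) × (Fin n → ℝ) => ρ.2 i)
    ((ContinuousLinearMap.proj (R := ℝ) (φ := fun _ : Fin n => ℝ) i).comp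
        (ContinuousLinearMap.snd ℝ (Fin n → ℝ) (Fin n → ℝ))) ρ :=
  ((ContinuousLinearMap.proj (R := ℝ) (φ := fun _ : Fin n => ℝ) i).comp
        (ContinuousLinearMap.snd ℝ (Fin n → ℝ) (Fin n → ℝ))).hasFDerivAt

theorem fderiv_qx {n : ℕ} (ρ w : (Fin n → ℝ) × (Fin n → ℝ)) :
    fderiv ℝ qx ρ w = ∑ i, 2 * ρ.1 i * w.1 i := by
  have h3 : HasFDerivAt (qx (n := n)) _ ρ := HasFDerivAt.fun_sum (u := Finset.univ)
    fun i _ => (hasFDerivAt_fst_apply i ρ).pow 2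
  rw [h3.fderiv]
  simp

theorem fderiv_xisq {n : ℕ} (ρ w : (Fin n → ℝ) × (Fin n → ℝ)) :
    fderiv ℝ xisq ρ w = ∑ i, 2 * ρ.2 i * w.2 i := by
  have h3 : HasFDerivAt (xisq (n := n)) _ ρ := HasFDerivAt.fun_sum (u := Finset.univ)
    fun i _ => (hasFDerivAt_snd_apply i ρ).pow 2
  rw [h3.fderiv]
  simp

theorem fderiv_xdot {n : ℕ} (ρ w : (Fin n → ℝ) × (Fin n → ℝ)) :
    fderiv ℝ xdot ρ w = ∑ i, (ρ.1 i * w.2 i + ρ.2 i * w.1 i) := by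
  have h3 : HasFDerivAt (xdot (n := n)) _ ρ := HasFDerivAt.fun_sum (u := Finset.univ)
    fun i _ => (hasFDerivAt_fst_apply i ρ).mul (hasFDerivAt_snd_apply i ρ)
  rw [h3.fderiv]
  simp

theorem Hvf_xisq {n : ℕ} (ρ : (Fin n → ℝ) × (Fin n → ℝ)) : Hvf xisq ρ = ((2:ℝ) • ρ.2, 0) := by
  unfold Hvf
  simp only [fderiv_xisq]
  ext i
  · simp [Pi.single_apply]
  · simp

theorem sum_sq_le {n : ℕ} (x : Fin n → ℝ) : ∑ i, x i ^ 2 ≤ n * ‖x‖ ^ 2 := by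
  have : ∀ i ∈ Finset.univ, x i ^ 2 ≤ ‖x‖ ^ 2 := fun i _ => by
    rw [← sq_abs (x i)]
    have := norm_le_pi_norm x i
    rw [Real.norm_eq_abs] at this
    gcongr
  refine (Finset.sum_le_sum this).trans ?_
  simp

theorem norm_sq_le_sum' {n : ℕ} (x : Fin n → ℝ) : ‖x‖ ^ 2 ≤ ∑ i, x i ^ 2 := by
  have := norm_sq_le_sum (x, (0 : Fin n → ℝ))
  simpa [Prod.norm_def] using this

theorem schrod_smooth {n : ℕ} (p : (Fin n → ℝ) × (Fin n → ℝ) → ℝ) (hp : IsSchrodingerSymbol p) :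
    ContDiff ℝ (⊤ : ℕ∞) p := by
  obtain ⟨a, b, c, δ, ha, hb, hc, -, -, -, -, -, -, h⟩ := hp
  have : p = fun ρ => (∑ i, (∑ j, a ρ.1 i j * ρ.2 j) * ρ.2 i) + (∑ i, b ρ.1 i * ρ.2 i) + c ρ.1 := by
    ext ⟨x, ξ⟩
    rw [h]
    rfl
  rw [this]
  have ha' : ∀ i j, ContDiff ℝ (⊤ : ℕ∞) (fun ρ : (Fin n → ℝ) × (Fin n → ℝ) => a ρ.1 i j) :=
    fun i j => (ha i j).comp contDiff_fst
  have hb' : ∀ i, ContDiff ℝ (⊤ : ℕ∞) (fun ρ : (Fin n → ℝ) × (Fin n → ℝ) => b ρ.1 i) :=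
    fun i => (contDiff_pi.1 hb i).comp contDiff_fst
  have hc' : ContDiff ℝ (⊤ : ℕ∞) (fun ρ : (Fin n → ℝ) × (Fin n → ℝ) => c ρ.1) := hc.comp contDiff_fst
  have hs : ∀ i, ContDiff ℝ (⊤ : ℕ∞) (fun ρ : (Fin n → ℝ) × (Fin n → ℝ) => ρ.2 i) := fun i => by fun_prop
  refine ((ContDiff.sum fun i _ => (ContDiff.sum fun j _ => (ha' i j).mul (hs j)).mul (hs i)).add
    (ContDiff.sum fun i _ => (hb' i).mul (hs i))).add hc'

theorem schrod_far {n : ℕ} (p : (Fin n → ℝ) × (Fin n → ℝ) → ℝ) (hp : IsSchrodingerSymbol p) :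
    ∃ X : ℝ, 0 ≤ X ∧ ∀ ρ, X < qx ρ → p ρ = xisq ρ ∧ Hvf p ρ = ((2:ℝ) • ρ.2, 0) := by
  obtain ⟨a, b, c, δ, -, -, -, -, -, -, ka, kb, kc, h⟩ := hp
  obtain ⟨ra, hra⟩ := ka.isBounded.subset_closedBall 0
  obtain ⟨rb, hrb⟩ := kb.isBounded.subset_closedBall 0
  obtain ⟨rc, hrc⟩ := kc.isBounded.subset_closedBall 0
  set r := max 0 (max ra (max rb rc)) with hr
  have hX : ∀ ρ : (Fin n → ℝ) × (Fin n → ℝ), n * r ^ 2 < qx ρ → p ρ = xisq ρ := by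
    rintro ⟨x, ξ⟩ hq
    have hrx : r < ‖x‖ := by
      by_contra hle
      push Not at hle
      have h1 := sum_sq_le x
      have h2 : (n:ℝ) * ‖x‖ ^ 2 ≤ n * r ^ 2 := by gcongr
      have h3 : qx (x, ξ) = ∑ i, x i ^ 2 := rfl
      linarith
    have h1 : ra < ‖x‖ := lt_of_le_of_lt ((le_max_left _ _).trans (le_max_right _ _)) hrx
    have h2 : rb < ‖x‖ := lt_of_le_of_lt ((le_max_left _ _).trans ((le_max_right _ _).trans (le_max_right _ _))) hrx
    have h3 : rc < ‖x‖ := lt_of_le_of_lt ((le_max_right _ _).trans ((le_max_right _ _).trans (le_max_right _ _))) hrx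
    have ea : a x - 1 = 0 := by
      refine image_eq_zero_of_notMem_tsupport (f := fun x => a x - 1) fun hm => ?_
      have := hra hm
      rw [mem_closedBall_zero_iff] at this
      linarith
    have eb : b x = 0 := by
      refine image_eq_zero_of_notMem_tsupport fun hm => ?_
      have := hrb hm
      rw [mem_closedBall_zero_iff] at this
      linarith
    have ec : c x = 0 := by
      refine image_eq_zero_of_notMem_tsupport fun hm => ?_
      have := hrc hm
      rw [mem_closedBall_zero_iff] at this
      linarith
    rw [sub_eq_zero] at ea
    rw [h, ea, eb, ec]
    simp [xisq, dotProduct, sq]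
  refine ⟨n * r ^ 2, by positivity, fun ρ hρ => ⟨hX ρ hρ, ?_⟩⟩
  have hev : p =ᶠ[nhds ρ] xisq := by
    filter_upwards [(isOpen_lt continuous_const qx_contDiff.continuous).mem_nhds hρ] with σ hσ
    exact hX σ hσ
  rw [← Hvf_xisq, Hvf_eq, Hvf_eq, hev.fderiv_eq]

theorem schrod_xi {n : ℕ} (p : (Fin n → ℝ) × (Fin n → ℝ) → ℝ) (hp : IsSchrodingerSymbol p) (e : ℝ) :
    ∃ Ξ : ℝ, ∀ ρ, p ρ ≤ e → ‖ρ.2‖ ≤ Ξ := by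
  obtain ⟨a, b, c, δ, -, hb, hc, -, hδ, hell, -, kb, kc, h⟩ := hp
  obtain ⟨Mb, hMb⟩ := hb.continuous.bounded_above_of_compact_support kb
  obtain ⟨Mc, hMc⟩ := hc.continuous.bounded_above_of_compact_support kc
  have hMb0 : 0 ≤ Mb := (norm_nonneg _).trans (hMb 0)
  have hMc0 : 0 ≤ Mc := (norm_nonneg _).trans (hMc 0)
  set S := |e| + n * Mb + Mc with hS
  have hS0 : 0 ≤ S := by positivity
  refine ⟨1 + S / δ, ?_⟩
  rintro ⟨x, ξ⟩ hρ
  show ‖ξ‖ ≤ _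
  rw [h] at hρ
  have h1 := (mul_le_mul_of_nonneg_left (norm_sq_le_sum' ξ) hδ.le).trans (hell x ξ)
  have h2 : -(n * Mb * ‖ξ‖) ≤ b x ⬝ᵥ ξ := by
    have : |b x ⬝ᵥ ξ| ≤ n * Mb * ‖ξ‖ := by
      unfold dotProduct
      refine (Finset.abs_sum_le_sum_abs _ _).trans ?_
      have : ∀ i ∈ Finset.univ, |b x i * ξ i| ≤ Mb * ‖ξ‖ := fun i _ => by
        rw [abs_mul]
        exact mul_le_mul ((norm_le_pi_norm (b x) i).trans (hMb x)) (norm_le_pi_norm ξ i) (abs_nonneg _) hMb0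
      refine (Finset.sum_le_sum this).trans ?_
      simp; linarith
    linarith [neg_abs_le (b x ⬝ᵥ ξ)]
  have h3 : -Mc ≤ c x := by
    have := hMc x
    rw [Real.norm_eq_abs] at this
    linarith [neg_abs_le (c x)]
  by_cases ht : ‖ξ‖ ≤ 1
  · have : 0 ≤ S / δ := by positivity
    linarith
  · push Not at ht
    have h4 : δ * ‖ξ‖ ^ 2 ≤ S * ‖ξ‖ := by
      have := le_abs_self e
      have : |e| ≤ |e| * ‖ξ‖ := le_mul_of_one_le_right (abs_nonneg _) ht.le
      have : Mc ≤ Mc * ‖ξ‖ := le_mul_of_one_le_right hMc0 ht.le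
      rw [hS]
      nlinarith
    have h5 : δ * ‖ξ‖ ≤ S := by
      have : 0 < ‖ξ‖ := by linarith
      by_contra hcon
      push Not at hcon
      nlinarith
    have h6 : ‖ξ‖ ≤ S / δ := by
      rw [le_div_iff₀ hδ]; linarith
    linarith

/-- the truncated field -/
theorem schrod_field {n : ℕ} (p : (Fin n → ℝ) × (Fin n → ℝ) → ℝ) (hp : IsSchrodingerSymbol p)
    (E₀ : ℝ) (hE₀ : 0 < E₀) :
    ∃ (v : (Fin n → ℝ) × (Fin n → ℝ) → (Fin n → ℝ) × (Fin n → ℝ)) (K M : NNReal),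
      LipschitzWith K v ∧ (∀ ρ, ‖v ρ‖ ≤ M) ∧ (∀ ρ, |p ρ - E₀| ≤ E₀ / 2 → v ρ = Hvf p ρ) ∧
      (∀ ρ, fderiv ℝ p ρ (v ρ) = 0) := by
  have hps := schrod_smooth p hp
  obtain ⟨X, hX0, hX⟩ := schrod_far p hp
  obtain ⟨Ξ, hΞ⟩ := schrod_xi p hp (2 * E₀)
  let θ : ContDiffBump E₀ := ⟨E₀ / 2, E₀, by positivity, by linarith⟩
  have hθ1 : ∀ t, |t - E₀| ≤ E₀ / 2 → θ t = 1 := fun t ht => by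
    apply θ.one_of_mem_closedBall
    rw [Metric.mem_closedBall, Real.dist_eq]; exact ht
  have hθ0 : ∀ t, 2 * E₀ < t → θ t = 0 := fun t ht => by
    apply θ.zero_of_le_dist
    rw [Real.dist_eq]
    show E₀ ≤ _
    rw [abs_of_pos (by linarith)]; linarith
  have hHs : ContDiff ℝ (⊤ : ℕ∞) (Hvf p) := by
    have hdp : ContDiff ℝ (⊤ : ℕ∞) (fderiv ℝ p) := hps.fderiv_right (by simp)
    exact (Jlin n).contDiff.comp hdp
  let v : (Fin n → ℝ) × (Fin n → ℝ) → (Fin n → ℝ) × (Fin n → ℝ) := fun ρ => θ (p ρ) • Hvf p ρ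
  let g : (Fin n → ℝ) → (Fin n → ℝ) × (Fin n → ℝ) := fun ξ => θ (∑ i, ξ i ^ 2) • ((2:ℝ) • ξ, 0)
  have hv : ContDiff ℝ (⊤ : ℕ∞) v := (θ.contDiff.comp hps).smul hHs
  have hg : ContDiff ℝ (⊤ : ℕ∞) g := by
    have h1 : ContDiff ℝ (⊤ : ℕ∞) (fun ξ : Fin n → ℝ => ∑ i, ξ i ^ 2) := by fun_prop
    have h2 : ContDiff ℝ (⊤ : ℕ∞) (fun ξ : Fin n → ℝ => (((2:ℝ) • ξ, 0) : (Fin n → ℝ) × (Fin n → ℝ))) := by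
      fun_prop
    exact (θ.contDiff.comp h1).smul h2
  have hbig : ∀ ξ : Fin n → ℝ, 2 * E₀ + 1 < ‖ξ‖ → 2 * E₀ < ∑ i, ξ i ^ 2 := fun ξ hξ => by
    have := norm_sq_le_sum' ξ
    nlinarith
  have hgc : HasCompactSupport g := by
    apply HasCompactSupport.intro (isCompact_closedBall (0 : Fin n → ℝ) (2 * E₀ + 1))
    intro ξ hξ
    rw [mem_closedBall_zero_iff, not_le] at hξ
    simp only [g]
    rw [hθ0 _ (hbig ξ hξ), zero_smul]
  let F : (Fin n → ℝ) × (Fin n → ℝ) → (Fin n → ℝ) × (Fin n → ℝ) := fun ρ => v ρ - g ρ.2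
  have hF : ContDiff ℝ (⊤ : ℕ∞) F := hv.sub (hg.comp contDiff_snd)
  have hFc : HasCompactSupport F := by
    apply HasCompactSupport.intro (isCompact_closedBall (0 : (Fin n → ℝ) × (Fin n → ℝ)) (max (X + 1) (max Ξ (2 * E₀ + 1))))
    intro ρ hρ
    rw [mem_closedBall_zero_iff, not_le, Prod.norm_def, lt_max_iff] at hρ
    by_cases hxi : max Ξ (2 * E₀ + 1) < ‖ρ.2‖
    · have h1 : 2 * E₀ < p ρ := by
        by_contra hle
        have := hΞ ρ (not_lt.1 hle)
        linarith [(le_max_left Ξ (2 * E₀ + 1))]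
      have h2 := hbig ρ.2 (lt_of_le_of_lt (le_max_right _ _) hxi)
      simp only [F, v, g]
      rw [hθ0 _ h1, hθ0 _ h2]; simp
    · rcases hρ with hρ | hρ
      · have h1 : X < qx ρ := by
          have h2 := norm_sq_le_sum' ρ.1
          have h3 : X + 1 < ‖ρ.1‖ := lt_of_le_of_lt (le_max_left _ _) hρ
          have h4 : qx ρ = ∑ i, ρ.1 i ^ 2 := rfl
          nlinarith
        obtain ⟨h2, h3⟩ := hX ρ h1
        simp only [F, v, g]
        rw [h3, h2]
        simp [xisq]
      · exact absurd (lt_of_le_of_lt (le_max_right _ _) hρ) hxi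
  obtain ⟨K₁, hK₁⟩ := hF.lipschitzWith_of_hasCompactSupport hFc (by simp)
  obtain ⟨K₂, hK₂⟩ := hg.lipschitzWith_of_hasCompactSupport hgc (by simp)
  obtain ⟨M₁, hM₁⟩ := hF.continuous.bounded_above_of_compact_support hFc
  obtain ⟨M₂, hM₂⟩ := hg.continuous.bounded_above_of_compact_support hgc
  have hvF : v = fun ρ => F ρ + g ρ.2 := by
    ext1 ρ; simp [F]
  have hM₁0 : 0 ≤ M₁ := (norm_nonneg _).trans (hM₁ 0)
  have hM₂0 : 0 ≤ M₂ := (norm_nonneg _).trans (hM₂ 0)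
  refine ⟨v, K₁ + K₂ * 1, ⟨M₁ + M₂, by positivity⟩, ?_, ?_, ?_, ?_⟩
  · rw [hvF]
    exact hK₁.add (hK₂.comp LipschitzWith.prod_snd)
  · intro ρ
    rw [hvF]
    exact (norm_add_le _ _).trans (add_le_add (hM₁ _) (hM₂ _))
  · intro ρ hρ
    simp only [v]
    rw [hθ1 _ hρ, one_smul]
  · intro ρ
    simp only [v, map_smul]
    rw [Hvf_eq, ← omega_Jlin]
    simp only [stdSymplectic]
    rw [smul_eq_mul]
    convert mul_zero _
    rw [sub_eq_zero]
    exact Finset.sum_congr rfl fun i _ => mul_comm _ _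


theorem flow_chain {n : ℕ} {v : (Fin n → ℝ) × (Fin n → ℝ) → (Fin n → ℝ) × (Fin n → ℝ)}
    {K : NNReal} {φ : ℝ → (Fin n → ℝ) × (Fin n → ℝ) → (Fin n → ℝ) × (Fin n → ℝ)}
    (h : IsFlow v K φ) (F : (Fin n → ℝ) × (Fin n → ℝ) → ℝ) (hF : ContDiff ℝ (⊤ : ℕ∞) F) (z) (t : ℝ) :
    HasDerivAt (fun s => F (φ s z)) (fderiv ℝ F (φ t z) (v (φ t z))) t :=
  ((hF.differentiable (by simp)).differentiableAt.hasFDerivAt).comp_hasDerivAt t (h.deriv z t)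

/-- no interior maximum of `q` in the free region -/
theorem no_max (Q D : ℝ → ℝ) (X R e : ℝ) (he : 0 < e) (hXR : X ≤ R)
    (hQc : Continuous Q) 
    (hQ : ∀ t, X < Q t → HasDerivAt Q (4 * D t) t)
    (hD : ∀ t, X < Q t → ∃ d, e ≤ d ∧ HasDerivAt D d t)
    (u t w : ℝ) (hut : u ≤ t) (htw : t ≤ w) (hu : Q u ≤ R) (hw : Q w ≤ R) : Q t ≤ R := by
  by_contra hlt
  push Not at hlt
  obtain ⟨m, hm, hmax⟩ := isCompact_Icc.exists_isMaxOn (Set.nonempty_Icc.2 (hut.trans htw)) hQc.continuousOn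
  have hmR : R < Q m := hlt.trans_le (hmax ⟨hut, htw⟩)
  have hmu : u < m := by
    rcases hm.1.lt_or_eq with h | h
    · exact h
    · rw [← h] at hmR; linarith
  have hmw : m < w := by
    rcases hm.2.lt_or_eq with h | h
    · exact h
    · rw [h] at hmR; linarith
  have hD0 : D m = 0 := by
    have hloc : IsLocalMax Q m := hmax.isLocalMax (Icc_mem_nhds hmu hmw)
    have := hloc.hasDerivAt_eq_zero (hQ m (by linarith))
    linarith
  have hopen : IsOpen {s | R < Q s} := isOpen_lt continuous_const hQc
  obtain ⟨d, hd, hball⟩ := Metric.isOpen_iff.1 hopen m hmR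
  set ε := min (d / 2) (w - m) with hε
  have hεp : 0 < ε := lt_min (by positivity) (by linarith)
  have hin : ∀ s ∈ Set.Icc m (m + ε), X < Q s := by
    intro s hs
    refine lt_of_le_of_lt hXR (hball ?_)
    rw [Metric.mem_ball, Real.dist_eq, abs_of_nonneg (by linarith [hs.1])]
    linarith [hs.2, min_le_left (d / 2) (w - m)]
  have hDm : StrictMonoOn D (Set.Icc m (m + ε)) := by
    apply strictMonoOn_of_deriv_pos (convex_Icc _ _)
    · intro s hs
      obtain ⟨d', -, h'⟩ := hD s (hin s hs)
      exact h'.continuousAt.continuousWithinAt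
    · intro s hs
      obtain ⟨d', hd', h'⟩ := hD s (hin s (interior_subset hs))
      rw [h'.deriv]; linarith
  have hQm : StrictMonoOn Q (Set.Icc m (m + ε)) := by
    apply strictMonoOn_of_deriv_pos (convex_Icc _ _) hQc.continuousOn
    intro s hs
    rw [(hQ s (hin s (interior_subset hs))).deriv]
    rw [interior_Icc] at hs
    have := hDm (Set.left_mem_Icc.2 (by linarith)) ⟨hs.1.le, hs.2.le⟩ hs.1
    linarith
  have h1 := hQm (Set.left_mem_Icc.2 (by linarith)) (Set.right_mem_Icc.2 (by linarith)) (show m < m + ε by linarith)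
  have h2 : Q (m + ε) ≤ Q m := hmax ⟨by linarith, by linarith [min_le_right (d / 2) (w - m)]⟩
  linarith

theorem schrod_setup {n : ℕ} (p : (Fin n → ℝ) × (Fin n → ℝ) → ℝ) (hp : IsSchrodingerSymbol p)
    (E₀ : ℝ) (hE₀ : 0 < E₀)
    (ρ₁ ρ₂ : (Fin n → ℝ) × (Fin n → ℝ)) (hne : ρ₁ ≠ ρ₂)
    (h₁ : Hvf p ρ₁ = 0) (h₂ : Hvf p ρ₂ = 0) (e₁ : p ρ₁ = E₀) (e₂ : p ρ₂ = E₀)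
    (hK : trappedSet p E₀ = {ρ₁, ρ₂} ∪ heteroclinicSet p ρ₁ ρ₂) :
    ∃ (v : (Fin n → ℝ) × (Fin n → ℝ) → (Fin n → ℝ) × (Fin n → ℝ)) (K M : NNReal)
      (φ : ℝ → (Fin n → ℝ) × (Fin n → ℝ) → (Fin n → ℝ) × (Fin n → ℝ)) (R Ξ : ℝ),
      LipschitzWith K v ∧ (∀ ρ, ‖v ρ‖ ≤ M) ∧ (∀ ρ, |p ρ - E₀| ≤ E₀ / 2 → v ρ = Hvf p ρ) ∧
      IsFlow v K φ ∧ (∀ R', R ≤ R' → Dyn K φ p qx R' E₀ (E₀ / 2) ρ₁ ρ₂) ∧ 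
      (∀ ρ, R < qx ρ → |p ρ - E₀| ≤ E₀ / 2 → E₀ ≤ fderiv ℝ xdot ρ (Hvf p ρ)) ∧
      (∀ ρ, |p ρ - E₀| ≤ E₀ / 2 → ‖ρ.2‖ ≤ Ξ) := by
  have hps := schrod_smooth p hp
  obtain ⟨X, hX0, hX⟩ := schrod_far p hp
  obtain ⟨Ξ, hΞ⟩ := schrod_xi p hp (2 * E₀)
  obtain ⟨v, K, M, hvK, hvM, hvH, hvp⟩ := schrod_field p hp E₀ hE₀
  obtain ⟨φ, hφ⟩ := exists_flow v K M hvK hvM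
  have hpinv : ∀ t z, p (φ t z) = p z := by
    intro t z
    have hd : ∀ s, HasDerivAt (fun s => p (φ s z)) 0 s := fun s => by
      have := flow_chain hφ p hps z s
      rwa [hvp] at this
    have := is_const_of_deriv_eq_zero (fun s => (hd s).differentiableAt) (fun s => (hd s).deriv) t 0
    simpa [hφ.zero] using this
  have hband : ∀ ρ, |p ρ - E₀| ≤ E₀ / 2 → p ρ ≤ 2 * E₀ ∧ E₀ / 2 ≤ p ρ := fun ρ hρ => by
    rw [abs_le] at hρ
    constructor <;> linarith [hρ.1, hρ.2]
  have hxd : ∀ ρ, X < qx ρ → |p ρ - E₀| ≤ E₀ / 2 → E₀ ≤ fderiv ℝ xdot ρ (Hvf p ρ) := by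
    intro ρ hρ hb
    obtain ⟨h3, h4⟩ := hX ρ hρ
    rw [fderiv_xdot, h4]
    have : ∑ i, (ρ.1 i * (((2:ℝ) • ρ.2, 0) : (Fin n → ℝ) × (Fin n → ℝ)).2 i + ρ.2 i * (((2:ℝ) • ρ.2, 0) : (Fin n → ℝ) × (Fin n → ℝ)).1 i) = 2 * xisq ρ := by
      rw [xisq, Finset.mul_sum]
      apply Finset.sum_congr rfl
      intro i _
      simp; ring
    rw [this, ← h3]
    linarith [(hband ρ hb).2]
  set R := max X (max (qx ρ₁) (qx ρ₂)) + 1 with hR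
  have hRX : X ≤ R := by linarith [le_max_left X (max (qx ρ₁) (qx ρ₂))]
  have hR1 : qx ρ₁ < R := by linarith [(le_max_left (qx ρ₁) (qx ρ₂)).trans (le_max_right X (max (qx ρ₁) (qx ρ₂)))]
  have hR2 : qx ρ₂ < R := by linarith [(le_max_right (qx ρ₁) (qx ρ₂)).trans (le_max_right X (max (qx ρ₁) (qx ρ₂)))]
  refine ⟨v, K, M, φ, R, Ξ, hvK, hvM, hvH, hφ, fun R' hR' => ?_, fun ρ hρ hb => hxd ρ (by linarith) hb,
    fun ρ hρ => hΞ ρ (hband ρ hρ).1⟩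
  have hxb : ∀ ρ : (Fin n → ℝ) × (Fin n → ℝ), qx ρ ≤ R' → ‖ρ.1‖ ≤ R' + 1 := by
    intro ρ hρ
    have h3 := norm_sq_le_sum' ρ.1
    have h4 : qx ρ = ∑ i, ρ.1 i ^ 2 := rfl
    nlinarith [norm_nonneg ρ.1]
  have hbdd : ∀ ρ, qx ρ ≤ R' → |p ρ - E₀| ≤ E₀ / 2 → ‖ρ‖ ≤ max (R' + 1) Ξ := by
    intro ρ h3 h4
    rw [Prod.norm_def]
    exact max_le_max (hxb ρ h3) (hΞ ρ (hband ρ h4).1)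
  refine ⟨hφ.zero, hφ.add, hφ.lip, hφ.continuous_time, hpinv, hps.continuous, qx_contDiff.continuous,
    by positivity, ?_, ?_, ?_, ?_, ?_, e₁, e₂, by linarith, by linarith, hne⟩
  · apply (isCompact_closedBall (0 : (Fin n → ℝ) × (Fin n → ℝ)) (max (R' + 1) Ξ)).of_isClosed_subset
    · exact (isClosed_le qx_contDiff.continuous continuous_const).inter
        (isClosed_le ((hps.continuous.sub continuous_const).abs) continuous_const)
    · intro ρ hρ
      rw [mem_closedBall_zero_iff]
      exact hbdd ρ hρ.1 hρ.2
  · intro z hz u t w hut htw hu hw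
    refine no_max (fun t => qx (φ t z)) (fun t => xdot (φ t z)) X R' E₀ hE₀ (by linarith)
      (qx_contDiff.continuous.comp (hφ.continuous_time z)) ?_ ?_ u t w hut htw hu hw
    · intro s hs
      have hbs : |p (φ s z) - E₀| ≤ E₀ / 2 := by rw [hpinv]; exact hz
      have := flow_chain hφ qx qx_contDiff z s
      rw [hvH _ hbs, (hX _ hs).2, fderiv_qx] at this
      convert this using 1
      rw [xdot, Finset.mul_sum]
      apply Finset.sum_congr rfl
      intro i _
      simp; ring
    · intro s hs
      have hbs : |p (φ s z) - E₀| ≤ E₀ / 2 := by rw [hpinv]; exact hz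
      have := flow_chain hφ xdot xdot_contDiff z s
      rw [hvH _ hbs] at this
      exact ⟨_, hxd _ hs hbs, this⟩
  · intro z hz hq
    have hbz : ∀ t, |p (φ t z) - E₀| ≤ E₀ / 2 := fun t => by
      rw [hpinv, hz, sub_self, abs_zero]; positivity
    have hmem : z ∈ trappedSet p E₀ := by
      refine ⟨hz, fun t => φ t z, hφ.zero z, fun t => ?_, ?_⟩
      · rw [← hvH _ (hbz t)]; exact hφ.deriv z t
      · refine (Metric.isBounded_closedBall (x := (0 : (Fin n → ℝ) × (Fin n → ℝ))) (r := max (R' + 1) Ξ)).subset ?_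
        rintro _ ⟨t, rfl⟩
        rw [mem_closedBall_zero_iff]
        exact hbdd _ (hq t) (hbz t)
    rw [hK] at hmem
    rcases hmem with (h | h) | ⟨γ, hγ, hb, ht, t₀, rfl⟩
    · exact Or.inl h
    · exact Or.inr (Or.inl h)
    · right; right
      have hpγ : ∀ t, p (γ t) = E₀ := by
        intro t
        have hd : ∀ s, HasDerivAt (fun s => p (γ s)) 0 s := fun s => by
          have := ((hps.differentiable (by simp)).differentiableAt (x := γ s)).hasFDerivAt.comp_hasDerivAt s (hγ s)
          have h0 : fderiv ℝ p (γ s) (Hvf p (γ s)) = 0 := by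
            rw [Hvf_eq, ← omega_Jlin, stdSymplectic, sub_eq_zero]
            exact Finset.sum_congr rfl fun i _ => mul_comm _ _
          rwa [h0] at this
        have := is_const_of_deriv_eq_zero (fun s => (hd s).differentiableAt) (fun s => (hd s).deriv) t t₀
        rw [← hz]; exact this
      have huniq : ∀ t, φ t (γ t₀) = γ (t + t₀) := by
        intro t
        have := hφ.uniq (fun s => γ (s + t₀)) (fun s => by
          have h5 := (hγ (s + t₀)).comp_add_const s t₀
          rw [← hvH _ (by rw [hpγ, sub_self, abs_zero]; positivity)] at h5
          exact h5) t
        simp only [zero_add] at this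
        exact this.symm
      simp only [huniq]
      exact ⟨hb.comp (tendsto_atBot_add_const_right _ _ tendsto_id), ht.comp (tendsto_atTop_add_const_right _ _ tendsto_id)⟩
  · intro t
    refine hφ.fixed ρ₁ ?_ t
    rw [hvH _ (by rw [e₁, sub_self, abs_zero]; positivity), h₁]
  · intro t
    refine hφ.fixed ρ₂ ?_ t
    rw [hvH _ (by rw [e₂, sub_self, abs_zero]; positivity), h₂]


theorem exists_lip_cutoff {E : Type*} [PseudoMetricSpace E] (A U : Set E) (hA : IsCompact A)
    (hU : IsOpen U) (hAU : A ⊆ U) : ∃ (χ : E → ℝ) (L : ℝ), 0 ≤ L ∧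
      (∀ z w, |χ z - χ w| ≤ L * dist z w) ∧ (∀ z, 0 ≤ χ z) ∧ (∀ z, χ z ≤ 1) ∧
      (∀ z ∈ A, χ z = 1) ∧ ∀ z, χ z ≠ 0 → z ∈ U := by
  rcases A.eq_empty_or_nonempty with rfl | hne
  · exact ⟨fun _ => 0, 0, le_rfl, by simp, by simp, by simp, by simp, by simp⟩
  obtain ⟨ε, hε, hsub⟩ := hA.exists_thickening_subset_open hU hAU
  refine ⟨fun z => max 0 (1 - Metric.infDist z A / ε), 1 / ε, by positivity, ?_, fun z => le_max_left _ _, ?_, ?_, ?_⟩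
  · intro z w
    have h1 : |Metric.infDist z A - Metric.infDist w A| ≤ dist z w := by
      have := (Metric.lipschitz_infDist_pt A).dist_le_mul z w
      simpa [Real.dist_eq] using this
    calc |max 0 (1 - Metric.infDist z A / ε) - max 0 (1 - Metric.infDist w A / ε)|
        ≤ |(1 - Metric.infDist z A / ε) - (1 - Metric.infDist w A / ε)| := by
          have := abs_max_sub_max_le_max 0 (1 - Metric.infDist z A / ε) 0 (1 - Metric.infDist w A / ε)
          simpa using this
      _ = |Metric.infDist z A - Metric.infDist w A| / ε := by
          rw [abs_sub_comm, ← abs_of_pos hε, ← abs_div, abs_of_pos hε]; congr 1; ring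
      _ ≤ 1 / ε * dist z w := by
          rw [div_mul_eq_mul_div, one_mul]; gcongr
  · intro z
    refine max_le zero_le_one ?_
    have : 0 ≤ Metric.infDist z A / ε := div_nonneg Metric.infDist_nonneg hε.le
    linarith
  · intro z hz
    simp [Metric.infDist_zero_of_mem hz]
  · intro z hz
    apply hsub
    by_contra hcon
    apply hz
    rw [Metric.mem_thickening_iff_infDist_lt hne, not_lt] at hcon
    apply max_eq_left
    have : 1 ≤ Metric.infDist z A / ε := (one_le_div hε).2 hcon
    linarith

theorem glue {E : Type*} [NormedAddCommGroup E] [NormedSpace ℝ E] [FiniteDimensional ℝ E]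
    (Q₁ Q₂ F : E → ℝ) (h₁ : ContDiff ℝ (⊤ : ℕ∞) Q₁)
    (h₂ : ContDiff ℝ (⊤ : ℕ∞) Q₂) (hF : ContDiff ℝ (⊤ : ℕ∞) F) (ρ₁ ρ₂ : E) (r : ℝ) (hr : 0 < r)
    (hr' : 4 * r < dist ρ₁ ρ₂) : ∃ G : E → ℝ, ContDiff ℝ (⊤ : ℕ∞) G ∧
      (∀ ρ, dist ρ ρ₁ < r → fderiv ℝ G ρ = fderiv ℝ Q₁ ρ) ∧
      (∀ ρ, dist ρ ρ₂ < r → fderiv ℝ G ρ = fderiv ℝ Q₂ ρ) ∧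
      ∀ ρ, 2 * r < dist ρ ρ₁ → 2 * r < dist ρ ρ₂ → G ρ = F ρ ∧ fderiv ℝ G ρ = fderiv ℝ F ρ := by
  let ψ₁ : ContDiffBump ρ₁ := ⟨r, 2 * r, hr, by linarith⟩
  let ψ₂ : ContDiffBump ρ₂ := ⟨r, 2 * r, hr, by linarith⟩
  have z₁ : ∀ ρ, 2 * r ≤ dist ρ ρ₁ → ψ₁ ρ = 0 := fun ρ h => ψ₁.zero_of_le_dist h
  have z₂ : ∀ ρ, 2 * r ≤ dist ρ ρ₂ → ψ₂ ρ = 0 := fun ρ h => ψ₂.zero_of_le_dist h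
  have o₁ : ∀ ρ, dist ρ ρ₁ < r → ψ₁ ρ = 1 := fun ρ h => ψ₁.one_of_mem_closedBall h.le
  have o₂ : ∀ ρ, dist ρ ρ₂ < r → ψ₂ ρ = 1 := fun ρ h => ψ₂.one_of_mem_closedBall h.le
  have e₁ : ∀ ρ, dist ρ ρ₁ < r → F ρ + ψ₁ ρ * (Q₁ ρ - F ρ) + ψ₂ ρ * (Q₂ ρ - F ρ) = Q₁ ρ := by
    intro ρ h
    rw [o₁ ρ h, z₂ ρ]; · ring
    have := dist_triangle_left ρ₁ ρ₂ ρ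
    linarith
  have e₂ : ∀ ρ, dist ρ ρ₂ < r → F ρ + ψ₁ ρ * (Q₁ ρ - F ρ) + ψ₂ ρ * (Q₂ ρ - F ρ) = Q₂ ρ := by
    intro ρ h
    rw [o₂ ρ h, z₁ ρ]; · ring
    have := dist_triangle_left ρ₁ ρ₂ ρ
    linarith
  have e₃ : ∀ ρ, 2 * r < dist ρ ρ₁ → 2 * r < dist ρ ρ₂ → F ρ + ψ₁ ρ * (Q₁ ρ - F ρ) + ψ₂ ρ * (Q₂ ρ - F ρ) = F ρ := by
    intro ρ h h'
    rw [z₁ ρ h.le, z₂ ρ h'.le]; ring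
  refine ⟨fun ρ => F ρ + ψ₁ ρ * (Q₁ ρ - F ρ) + ψ₂ ρ * (Q₂ ρ - F ρ),
    (hF.add (ψ₁.contDiff.mul (h₁.sub hF))).add (ψ₂.contDiff.mul (h₂.sub hF)), ?_, ?_, ?_⟩
  · intro ρ h
    refine Filter.EventuallyEq.fderiv_eq ?_
    filter_upwards [(isOpen_lt (continuous_id.dist continuous_const) continuous_const).mem_nhds h] with y hy
    exact e₁ y hy
  · intro ρ h
    refine Filter.EventuallyEq.fderiv_eq ?_
    filter_upwards [(isOpen_lt (continuous_id.dist continuous_const) continuous_const).mem_nhds h] with y hy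
    exact e₂ y hy
  · intro ρ h h'
    refine ⟨e₃ ρ h h', Filter.EventuallyEq.fderiv_eq ?_⟩
    filter_upwards [(isOpen_lt continuous_const (continuous_id.dist continuous_const)).mem_nhds h,
      (isOpen_lt continuous_const (continuous_id.dist continuous_const)).mem_nhds h'] with y hy hy'
    exact e₃ y hy hy'

theorem exists_slow_cutoff (E : Type*) [NormedAddCommGroup E] [NormedSpace ℝ E] [FiniteDimensional ℝ E] :
    ∃ C : ℝ, 0 ≤ C ∧ ∀ L : ℝ, 0 < L → ∃ ζ : E → ℝ, ContDiff ℝ (⊤ : ℕ∞) ζ ∧ (∀ z, 0 ≤ ζ z) ∧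
      (∀ z, ζ z ≤ 1) ∧ (∀ z, ‖z‖ < L → ζ z = 1 ∧ fderiv ℝ ζ z = 0) ∧ (∀ z, 2 * L ≤ ‖z‖ → ζ z = 0) ∧
      ∀ z w, |fderiv ℝ ζ z w| ≤ C / L * ‖w‖ := by
  let ψ : ContDiffBump (0 : E) := ⟨1, 2, one_pos, one_lt_two⟩
  have hψ : ContDiff ℝ (⊤ : ℕ∞) (ψ : E → ℝ) := ψ.contDiff
  have hc : Continuous (fderiv ℝ (ψ : E → ℝ)) := hψ.continuous_fderiv (by simp)
  obtain ⟨C, hC⟩ := (ψ.hasCompactSupport.fderiv (𝕜 := ℝ)).exists_bound_of_continuous hc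
  refine ⟨C, (norm_nonneg _).trans (hC 0), fun L hL => ?_⟩
  have o : ∀ z : E, ‖z‖ < L → ψ (L⁻¹ • z) = 1 := by
    intro z hz
    apply ψ.one_of_mem_closedBall
    rw [mem_closedBall_zero_iff, norm_smul, norm_inv, Real.norm_of_nonneg hL.le]
    show L⁻¹ * ‖z‖ ≤ 1
    rw [inv_mul_le_iff₀ hL]; linarith
  refine ⟨fun z => ψ (L⁻¹ • z), hψ.comp (contDiff_const_smul _), fun z => ψ.nonneg, fun z => ψ.le_one, ?_, ?_, ?_⟩
  · intro z hz
    refine ⟨o z hz, ?_⟩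
    have : (fun z => ψ (L⁻¹ • z)) =ᶠ[nhds z] fun _ => (1 : ℝ) := by
      filter_upwards [(isOpen_lt continuous_norm continuous_const).mem_nhds hz] with y hy
      exact o y hy
    rw [this.fderiv_eq]; simp
  · intro z hz
    apply ψ.zero_of_le_dist
    show 2 ≤ dist _ _
    rw [dist_zero_right, norm_smul, norm_inv, Real.norm_of_nonneg hL.le, le_inv_mul_iff₀ hL]
    linarith
  · intro z w
    have hd : HasFDerivAt (fun z : E => ψ (L⁻¹ • z)) ((fderiv ℝ ψ (L⁻¹ • z)).comp (L⁻¹ • ContinuousLinearMap.id ℝ E)) z := by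
      refine HasFDerivAt.comp (g := (ψ : E → ℝ)) (f := fun z => L⁻¹ • z) z ((hψ.differentiable (by simp)).differentiableAt.hasFDerivAt) ?_
      exact (hasFDerivAt_id z).const_smul L⁻¹
    rw [hd.fderiv]
    simp only [ContinuousLinearMap.comp_apply, _root_.smul_apply, ContinuousLinearMap.id_apply, map_smul, smul_eq_mul]
    rw [abs_mul, abs_of_pos (inv_pos.2 hL)]
    have := (fderiv ℝ (ψ : E → ℝ) (L⁻¹ • z)).le_of_opNorm_le (hC _) w
    rw [Real.norm_eq_abs] at this
    calc L⁻¹ * |fderiv ℝ (ψ : E → ℝ) (L⁻¹ • z) w| ≤ L⁻¹ * (C * ‖w‖) := by gcongr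
      _ = _ := by ring


theorem hvf_cont {n : ℕ} (p : (Fin n → ℝ) × (Fin n → ℝ) → ℝ) (hp : ContDiff ℝ (⊤ : ℕ∞) p) :
    Continuous (Hvf p) := by
  have hc : Continuous (fderiv ℝ p) := hp.continuous_fderiv (by simp)
  unfold Hvf
  refine Continuous.prodMk ?_ ?_
  · exact continuous_pi fun i => hc.clm_apply continuous_const
  · exact continuous_pi fun i => (hc.clm_apply continuous_const).neg

theorem fderiv_final {E : Type*} [NormedAddCommGroup E] [NormedSpace ℝ E] (G₀ ζ g : E → ℝ)
    (N : ℝ) (h₀ : ContDiff ℝ (⊤ : ℕ∞) G₀) (hζ : ContDiff ℝ (⊤ : ℕ∞) ζ)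
    (hg : ContDiff ℝ (⊤ : ℕ∞) g) (z w : E) :
    fderiv ℝ (fun x => G₀ x + N * (ζ x * g x)) z w =
      fderiv ℝ G₀ z w + N * (ζ z * fderiv ℝ g z w + g z * fderiv ℝ ζ z w) := by
  have d₀ := (h₀.differentiable (by simp)).differentiableAt (x := z)
  have d₁ := (hζ.differentiable (by simp)).differentiableAt (x := z)
  have d₂ := (hg.differentiable (by simp)).differentiableAt (x := z)
  have := d₀.hasFDerivAt.add ((d₁.hasFDerivAt.mul d₂.hasFDerivAt).const_mul N)
  have h := this.fderiv
  have e : (fun x => G₀ x + N * (ζ x * g x)) = (G₀ + fun y => N * (ζ * g) y) := rfl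
  rw [e, h]
  simp
  ring

theorem stmt_0 {n : ℕ} (hn : 1 ≤ n)
    (p : (Fin n → ℝ) × (Fin n → ℝ) → ℝ) (hp : IsSchrodingerSymbol p)
    (E₀ : ℝ) (hE₀ : 0 < E₀)
    (ρ₁ ρ₂ : (Fin n → ℝ) × (Fin n → ℝ)) (hne : ρ₁ ≠ ρ₂)
    (h₁ : IsHyperbolicFixedPt p E₀ ρ₁) (h₂ : IsHyperbolicFixedPt p E₀ ρ₂)
    (hK : trappedSet p E₀ = {ρ₁, ρ₂} ∪ heteroclinicSet p ρ₁ ρ₂) :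
    ∃ (δ c : ℝ) (G : (Fin n → ℝ) × (Fin n → ℝ) → ℝ),
      0 < δ ∧ 0 < c ∧ ContDiff ℝ (⊤ : ℕ∞) G ∧
      (∃ K : Set ((Fin n → ℝ) × (Fin n → ℝ)), IsCompact K ∧
        ∀ ρ ∉ K, G ρ = ∑ i, ρ.1 i * ρ.2 i) ∧
      ∀ ρ, p ρ ∈ Set.Icc (E₀ - δ) (E₀ + δ) →
        c * min (Metric.infDist ρ ({ρ₁, ρ₂} : Set _) ^ 2) 1 ≤
          fderiv ℝ G ρ (Hvf p ρ) := by
  have hps : ContDiff ℝ (⊤ : ℕ∞) p := schrod_smooth p hp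
  obtain ⟨v, K, M, φ, R, Ξ, hvL, hvM, hvH, hφ, hDyn, hfar, hΞ⟩ :=
    schrod_setup p hp E₀ hE₀ ρ₁ ρ₂ hne h₁.1 h₂.1 h₁.2.1 h₂.2.1 hK
  obtain ⟨Q₁, c₁, r₁, hQ₁, hc₁, hr₁, hloc₁⟩ := hyp_local p hps E₀ ρ₁ h₁
  obtain ⟨Q₂, c₂, r₂, hQ₂, hc₂, hr₂, hloc₂⟩ := hyp_local p hps E₀ ρ₂ h₂
  have hD0 := hDyn R le_rfl
  have hD := hDyn (R + 1) (by linarith)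
  have hqc : Continuous (qx (n := n)) := hD.q_cont
  have hdpos : 0 < dist ρ₁ ρ₂ := dist_pos.2 hne
  -- radii
  obtain ⟨t₁, ht₁, hb₁⟩ := Metric.isOpen_iff.1 (isOpen_lt hqc continuous_const) ρ₁ hD0.q₁
  obtain ⟨t₂, ht₂, hb₂⟩ := Metric.isOpen_iff.1 (isOpen_lt hqc continuous_const) ρ₂ hD0.q₂
  obtain ⟨r₀, hr₀, hr₀₁, hr₀₂, hrt₁, hrt₂, hrd⟩ : ∃ r₀ : ℝ, 0 < r₀ ∧ r₀ ≤ r₁ ∧ r₀ ≤ r₂ ∧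
      4 * r₀ ≤ t₁ ∧ 4 * r₀ ≤ t₂ ∧ 8 * r₀ ≤ dist ρ₁ ρ₂ := by
    refine ⟨min (min r₁ r₂) (min (min t₁ t₂) (dist ρ₁ ρ₂)) / 8, by positivity, ?_⟩
    have a1 := min_le_left (min r₁ r₂) (min (min t₁ t₂) (dist ρ₁ ρ₂))
    have a2 := min_le_right (min r₁ r₂) (min (min t₁ t₂) (dist ρ₁ ρ₂))
    have a3 := min_le_left r₁ r₂
    have a4 := min_le_right r₁ r₂
    have a5 := min_le_left (min t₁ t₂) (dist ρ₁ ρ₂)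
    have a6 := min_le_right (min t₁ t₂) (dist ρ₁ ρ₂)
    have a7 := min_le_left t₁ t₂
    have a8 := min_le_right t₁ t₂
    have a9 : 0 < min (min r₁ r₂) (min (min t₁ t₂) (dist ρ₁ ρ₂)) := by positivity
    refine ⟨?_, ?_, ?_, ?_, ?_⟩ <;> linarith
  obtain ⟨G₀, hG₀, hG₁, hG₂, hGF⟩ := glue Q₁ Q₂ xdot hQ₁ hQ₂ xdot_contDiff ρ₁ ρ₂ r₀ hr₀ (by linarith)
  have hout : ∀ ρ, R ≤ qx ρ → 2 * r₀ < dist ρ ρ₁ ∧ 2 * r₀ < dist ρ ρ₂ := by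
    intro ρ hρ
    constructor
    · by_contra hcon
      push Not at hcon
      have : qx ρ < R := hb₁ (show dist ρ ρ₁ < t₁ by linarith)
      linarith
    · by_contra hcon
      push Not at hcon
      have : qx ρ < R := hb₂ (show dist ρ ρ₂ < t₂ by linarith)
      linarith
  obtain ⟨δ, s, hδ, hδ', hs, hsr, hval⟩ := hD.exists_value (r₀ / 2) (by positivity) (by linarith)
  -- cutoff chi
  have hpc : Continuous p := hps.continuous
  have hAc : IsCompact {z : (Fin n → ℝ) × (Fin n → ℝ) | qx z ≤ R ∧ |p z - E₀| ≤ δ / 2 ∧ r₀ ≤ dist z ρ₁ ∧ r₀ ≤ dist z ρ₂} := by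
    refine hD0.cpt.of_isClosed_subset ?_ ?_
    · simp only [Set.setOf_and]
      refine (isClosed_le hqc continuous_const).inter ((isClosed_le (hpc.sub continuous_const).abs continuous_const).inter
        ((isClosed_le continuous_const (continuous_id.dist continuous_const)).inter
          (isClosed_le continuous_const (continuous_id.dist continuous_const))))
    · rintro z ⟨hz1, hz2, -⟩
      exact ⟨hz1, hz2.trans (by linarith)⟩
  have hUo : IsOpen {z : (Fin n → ℝ) × (Fin n → ℝ) | qx z < R + 1 ∧ |p z - E₀| < δ ∧ r₀ / 2 < dist z ρ₁ ∧ r₀ / 2 < dist z ρ₂} := by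
    simp only [Set.setOf_and]
    exact (isOpen_lt hqc continuous_const).inter ((isOpen_lt (hpc.sub continuous_const).abs continuous_const).inter
      ((isOpen_lt continuous_const (continuous_id.dist continuous_const)).inter
        (isOpen_lt continuous_const (continuous_id.dist continuous_const))))
  obtain ⟨χ, Lχ, hLχ, hχL, hχ0, hχ1, hχA, hχU⟩ := exists_lip_cutoff _ _ hAc hUo (by
    rintro z ⟨a, b, c, d⟩
    exact ⟨by linarith, by linarith, by linarith, by linarith⟩)
  obtain ⟨C, hC, hval⟩ := hval χ Lχ hLχ hχL hχ0 hχ1 (fun z hz => by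
    obtain ⟨a, b, c, d⟩ := hχU z hz
    exact ⟨a.le, b.le, c.le, d.le⟩)
  -- lower bound for G₀
  have hcontG : Continuous fun ρ => fderiv ℝ G₀ ρ (Hvf p ρ) :=
    (hG₀.continuous_fderiv (by simp)).clm_apply (hvf_cont p hps)
  obtain ⟨e, he⟩ := hD0.cpt.exists_bound_of_continuousOn hcontG.continuousOn
  have he0 : 0 ≤ e := (norm_nonneg _).trans (he ρ₁ ⟨hD0.q₁.le, by rw [h₁.2.1, sub_self, abs_zero]; positivity⟩)
  obtain ⟨N, hN⟩ : ∃ N, N = e + 2 := ⟨_, rfl⟩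
  have hNpos : 0 < N := by linarith
  obtain ⟨c₀, hc₀, hc₀₁, hc₀₂⟩ : ∃ c₀ : ℝ, 0 < c₀ ∧ c₀ ≤ c₁ ∧ c₀ ≤ c₂ :=
    ⟨min c₁ c₂, lt_min hc₁ hc₂, min_le_left _ _, min_le_right _ _⟩
  obtain ⟨η, hη, hη1, hη2, hη3, hη4⟩ : ∃ η : ℝ, 0 < η ∧ N * (η + η) ≤ c₀ / 2 * (s / 2) ^ 2 ∧
      N * (η + η) ≤ E₀ / 4 ∧ N * (η + η) ≤ 1 ∧ η ≤ min (s / 2) 1 := by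
    refine ⟨min (min (c₀ / 2 * (s / 2) ^ 2) (min (E₀ / 4) 1) / (2 * N)) (min (s / 2) 1), by positivity, ?_⟩
    generalize hm : min (c₀ / 2 * (s / 2) ^ 2) (min (E₀ / 4) 1) = m
    have b1 : m ≤ c₀ / 2 * (s / 2) ^ 2 := hm ▸ min_le_left _ _
    have b2 : m ≤ E₀ / 4 := hm ▸ (min_le_right _ _).trans (min_le_left _ _)
    have b3 : m ≤ 1 := hm ▸ (min_le_right _ _).trans (min_le_right _ _)
    have b4 : N * (min (m / (2 * N)) (min (s / 2) 1) + min (m / (2 * N)) (min (s / 2) 1)) ≤ m := by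
      have : min (m / (2 * N)) (min (s / 2) 1) ≤ m / (2 * N) := min_le_left _ _
      calc _ ≤ N * (m / (2 * N) + m / (2 * N)) := by gcongr
        _ = m := by field_simp; ring
    exact ⟨b4.trans b1, b4.trans b2, b4.trans b3, min_le_right _ _⟩
  have hηs : η ≤ s / 2 := hη4.trans (min_le_left _ _)
  have hη1' : η ≤ 1 := hη4.trans (min_le_right _ _)
  obtain ⟨f, Lf, hLf, hfL, hf0, hfC, hfv, ⟨k₁, hk₁⟩, ⟨k₂, hk₂⟩⟩ := hval η hη
  obtain ⟨g, hg, hgv, hgf, hgc⟩ := smoothing hφ hvL M hvM χ f Lχ Lf η η hLχ hLf hη hχL hfL hfv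
  have hgB : ∀ z, |g z| ≤ C + 1 := by
    intro z
    have a := abs_le.1 (hgf z)
    have b := hf0 z
    have c := hfC z
    rw [abs_le]; constructor <;> linarith [a.1, a.2]
  have hgconst : ∀ (ρ₀ : (Fin n → ℝ) × (Fin n → ℝ)) (k : ℝ), (∀ z, dist z ρ₀ < s → f z = k) → ∀ z, dist z ρ₀ < s / 2 → fderiv ℝ g z = 0 := by
    intro ρ₀ k hk z hz
    have : g =ᶠ[nhds z] fun _ => k := by
      filter_upwards [(isOpen_lt (continuous_id.dist continuous_const) continuous_const).mem_nhds hz] with y hy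
      refine hgc y k fun x hx => hk x ?_
      have := dist_triangle x y ρ₀
      simp only [id] at hy
      linarith
    rw [this.fderiv_eq]; simp
  -- slow cutoff
  obtain ⟨C₁, hC₁, hslow⟩ := exists_slow_cutoff ((Fin n → ℝ) × (Fin n → ℝ))
  obtain ⟨B, hB⟩ := hD0.cpt.isBounded.exists_norm_le
  obtain ⟨L, hL, hLB, hLE⟩ : ∃ L : ℝ, 0 < L ∧ B < L ∧ N * (C + 1) * C₁ * M / L ≤ E₀ / 4 := by
    have hX : 0 ≤ N * (C + 1) * C₁ * M := by positivity
    refine ⟨|B| + 1 + N * (C + 1) * C₁ * M / (E₀ / 4), by positivity, ?_, ?_⟩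
    · have := le_abs_self B
      have : 0 ≤ N * (C + 1) * C₁ * M / (E₀ / 4) := by positivity
      linarith
    · rw [div_le_iff₀ (by positivity), mul_add (E₀ / 4)]
      have : E₀ / 4 * (N * (C + 1) * C₁ * M / (E₀ / 4)) = N * (C + 1) * C₁ * M := by field_simp
      rw [this]
      have : 0 ≤ E₀ / 4 * (|B| + 1) := by positivity
      linarith
  obtain ⟨ζ, hζ, hζ0, hζ1, hζi, hζo, hζd⟩ := hslow L hL
  refine ⟨δ / 2, min (c₀ / 2) (min 1 (E₀ / 2)), fun x => G₀ x + N * (ζ x * g x), by positivity, by positivity,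
    hG₀.add (contDiff_const.mul (hζ.mul hg)), ?_, ?_⟩
  · refine ⟨Metric.closedBall 0 (2 * L) ∪ (Metric.closedBall ρ₁ (2 * r₀) ∪ Metric.closedBall ρ₂ (2 * r₀)),
      (isCompact_closedBall _ _).union ((isCompact_closedBall _ _).union (isCompact_closedBall _ _)), ?_⟩
    intro ρ hρ
    simp only [Set.mem_union, not_or, Metric.mem_closedBall, not_le, dist_zero_right] at hρ
    obtain ⟨a, b, c⟩ := hρ
    show G₀ ρ + N * (ζ ρ * g ρ) = xdot ρ
    rw [hζo ρ a.le, (hGF ρ b c).1]; ring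
  intro ρ hρ
  have hband : |p ρ - E₀| ≤ δ / 2 := by
    rw [abs_le]; constructor <;> linarith [hρ.1, hρ.2]
  have hband2 : |p ρ - E₀| ≤ E₀ / 2 := by linarith
  have hv := hvH ρ hband2
  rw [fderiv_final G₀ ζ g N hG₀ hζ hg]
  have hgv' := hgv ρ
  rw [hv] at hgv'
  have hχ0' := hχ0 ρ
  -- final comparison
  have hfin1 : ∀ X : ℝ, min 1 (E₀ / 2) ≤ X → min (c₀ / 2) (min 1 (E₀ / 2)) * min (Metric.infDist ρ ({ρ₁, ρ₂} : Set _) ^ 2) 1 ≤ X := by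
    intro X hX
    refine le_trans ?_ ((min_le_right (c₀ / 2) _).trans hX)
    exact mul_le_of_le_one_right (by positivity) (min_le_right _ _)
  have hfin2 : ∀ X : ℝ, ∀ ρ₀ ∈ ({ρ₁, ρ₂} : Set _), c₀ / 2 * dist ρ ρ₀ ^ 2 ≤ X → min (c₀ / 2) (min 1 (E₀ / 2)) * min (Metric.infDist ρ ({ρ₁, ρ₂} : Set _) ^ 2) 1 ≤ X := by
    intro X ρ₀ hm hX
    refine le_trans ?_ hX
    have h5 : Metric.infDist ρ ({ρ₁, ρ₂} : Set _) ≤ dist ρ ρ₀ := Metric.infDist_le_dist_of_mem hm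
    have h6 : 0 ≤ Metric.infDist ρ ({ρ₁, ρ₂} : Set _) := Metric.infDist_nonneg
    refine mul_le_mul (min_le_left _ _) ((min_le_left _ _).trans ?_) (by positivity) (by positivity)
    gcongr
  rcases lt_or_ge R (qx ρ) with hq | hq
  · -- far region
    apply hfin1
    refine (min_le_right _ _).trans ?_
    have h7 := hout ρ hq.le
    rw [(hGF ρ h7.1 h7.2).2]
    have h8 := hfar ρ hq hband2
    have h9 : -(η + η) ≤ ζ ρ * fderiv ℝ g ρ (Hvf p ρ) := by
      have := mul_le_mul_of_nonneg_left (show -(η + η) ≤ fderiv ℝ g ρ (Hvf p ρ) by linarith) (hζ0 ρ)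
      have h10 := hζ1 ρ
      nlinarith
    have h10 : |g ρ * fderiv ℝ ζ ρ (Hvf p ρ)| ≤ (C + 1) * (C₁ / L * M) := by
      rw [abs_mul]
      refine mul_le_mul (hgB ρ) ((hζd ρ _).trans ?_) (abs_nonneg _) (by positivity)
      rw [← hv]
      exact mul_le_mul_of_nonneg_left (hvM ρ) (by positivity)
    have h11 := (abs_le.1 h10).1
    have h12 : N * ((C + 1) * (C₁ / L * M)) ≤ E₀ / 4 := by
      refine le_trans (le_of_eq ?_) hLE
      ring
    have h13 := mul_le_mul_of_nonneg_left h9 hNpos.le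
    have h14 := mul_le_mul_of_nonneg_left h11 hNpos.le
    linarith
  · have hρL : ‖ρ‖ < L := (hB ρ ⟨hq, hband2⟩).trans_lt hLB
    obtain ⟨hz1, hz2⟩ := hζi ρ hρL
    rw [hz1, hz2]
    simp only [one_mul, _root_.zero_apply, mul_zero, add_zero]
    have hnear : ∀ (ρ₀ : (Fin n → ℝ) × (Fin n → ℝ)) (c' k : ℝ), c₀ ≤ c' → c' * dist ρ ρ₀ ^ 2 ≤ fderiv ℝ G₀ ρ (Hvf p ρ) →
        (∀ z, dist z ρ₀ < s → f z = k) → c₀ / 2 * dist ρ ρ₀ ^ 2 ≤ fderiv ℝ G₀ ρ (Hvf p ρ) + N * fderiv ℝ g ρ (Hvf p ρ) := by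
      intro ρ₀ c' k hcc hG hk
      have hsq : 0 ≤ dist ρ ρ₀ ^ 2 := sq_nonneg _
      have hcc' := mul_le_mul_of_nonneg_right hcc hsq
      have hcc2 := mul_nonneg hc₀.le hsq
      rcases lt_or_ge (dist ρ ρ₀) (s / 2) with hd | hd
      · rw [hgconst ρ₀ k hk ρ hd]
        simp only [_root_.zero_apply, mul_zero, add_zero]
        linarith
      · have h15 : (s / 2) ^ 2 ≤ dist ρ ρ₀ ^ 2 := by gcongr
        have h16 := mul_le_mul_of_nonneg_left h15 (show 0 ≤ c₀ / 2 by positivity)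
        have h17 := mul_le_mul_of_nonneg_left (show -(η + η) ≤ fderiv ℝ g ρ (Hvf p ρ) by linarith) hNpos.le
        linarith
    rcases lt_or_ge (dist ρ ρ₁) r₀ with hd₁ | hd₁
    · refine hfin2 _ ρ₁ (by simp) (hnear ρ₁ c₁ k₁ hc₀₁ ?_ hk₁)
      rw [hG₁ ρ hd₁]
      exact hloc₁ ρ (by linarith)
    rcases lt_or_ge (dist ρ ρ₂) r₀ with hd₂ | hd₂
    · refine hfin2 _ ρ₂ (by simp) (hnear ρ₂ c₂ k₂ hc₀₂ ?_ hk₂)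
      rw [hG₂ ρ hd₂]
      exact hloc₂ ρ (by linarith)
    apply hfin1
    refine (min_le_left _ _).trans ?_
    rw [hχA ρ ⟨hq, hband, hd₁, hd₂⟩] at hgv'
    have h18 := he ρ ⟨hq, hband2⟩
    rw [Real.norm_eq_abs] at h18
    have h19 := (abs_le.1 h18).1
    have h20 := mul_le_mul_of_nonneg_left hgv' hNpos.le
    have h21 : N * (1 - η - η) = N - N * (η + η) := by ring
    linarith
end

section
/- On ℝ⁴ with coordinates (x, y, ξ, η), let p(x,y,ξ,η) = (ξ² − 1)(ξ² − 4) + η⁴ + η² + r(x,ξ)χ(y) + λ(e^{−y²} − 1), where: r is smooth, there is a compact set K_x ⊆ ℝ with r(x,ξ) = 0 for x ∉ K_x, and |r(x,ξ)| ≤ M(1 + ξ²)^{3/2} for some M > 0; χ ∈ C_c^∞(ℝ; [0,1]) equals 1 in a neighborhood of 0 and supp χ′ ⊆ {y : 1/C ≤ |y| ≤ C} for some C > 1. Then there exists λ₀ > 0 such that for every λ ≥ λ₀, every bounded Hamiltonian trajectory γ : ℝ → ℝ⁴ of p contained in the zero level set p⁻¹(0) satisfies y(t) = 0 and η(t) =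 0 for all t ∈ ℝ. -/
/-- The Hamiltonian vector field `H_p = (∂_ξ p, ∂_η p, −∂_x p, −∂_y p)` of a symbol on
`ℝ² × ℝ²` with coordinates `((x, y), (ξ, η))`. -/
noncomputable def Hvf4 (p : (ℝ × ℝ) × (ℝ × ℝ) → ℝ) (ρ : (ℝ × ℝ) × (ℝ × ℝ)) :
    (ℝ × ℝ) × (ℝ × ℝ) :=
  ((fderiv ℝ p ρ ((0, 0), (1, 0)), fderiv ℝ p ρ ((0, 0), (0, 1))),
   (-fderiv ℝ p ρ ((1, 0), (0, 0)), -fderiv ℝ p ρ ((0, 1), (0, 0))))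

/-- The order-4 symbol `p = (ξ² − 1)(ξ² − 4) + η⁴ + η² + r(x,ξ)χ(y) + λ(e^{−y²} − 1)`. -/
noncomputable def P6 (r : ℝ × ℝ → ℝ) (χ : ℝ → ℝ) (lam : ℝ)
    (ρ : (ℝ × ℝ) × (ℝ × ℝ)) : ℝ :=
  (ρ.2.1 ^ 2 - 1) * (ρ.2.1 ^ 2 - 4) + ρ.2.2 ^ 4 + ρ.2.2 ^ 2
    + r (ρ.1.1, ρ.2.1) * χ ρ.1.2 + lam * (Real.exp (-ρ.1.2 ^ 2) - 1)

theorem aux_diff (r : ℝ × ℝ → ℝ) (hr : ContDiff ℝ (⊤ : ℕ∞) r) (χ : ℝ → ℝ)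
    (hχ : ContDiff ℝ (⊤ : ℕ∞) χ) (lam : ℝ) : Differentiable ℝ (P6 r χ lam) := by
  have h1 : Differentiable ℝ r := hr.differentiable (by simp)
  have h2 : Differentiable ℝ χ := hχ.differentiable (by simp)
  unfold P6
  fun_prop

theorem aux_eta (r : ℝ × ℝ → ℝ) (hr : ContDiff ℝ (⊤ : ℕ∞) r) (χ : ℝ → ℝ)
    (hχ : ContDiff ℝ (⊤ : ℕ∞) χ) (lam : ℝ) (ρ : (ℝ × ℝ) × (ℝ × ℝ)) :
    fderiv ℝ (P6 r χ lam) ρ ((0, 0), (0, 1)) = 4 * ρ.2.2 ^ 3 + 2 * ρ.2.2 := by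
  have hd := (aux_diff r hr χ hχ lam ρ).hasFDerivAt.hasLineDerivAt ((0, 0), (0, 1))
  refine HasDerivAt.unique hd ?_
  obtain ⟨⟨x, y⟩, ⟨ξ, η⟩⟩ := ρ
  simp only [P6, Prod.smul_mk, Prod.mk_add_mk, smul_eq_mul, mul_zero, add_zero, mul_one]
  have h0 : HasDerivAt (fun t : ℝ => η + t) 1 0 := (hasDerivAt_id (0 : ℝ)).const_add η
  have := ((((h0.pow 4).const_add ((ξ ^ 2 - 1) * (ξ ^ 2 - 4))).add (h0.pow 2)).add_const
    (r (x, ξ) * χ y)).add_const (lam * (Real.exp (-y ^ 2) - 1))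
  refine this.congr_deriv ?_
  simp

theorem aux_y (r : ℝ × ℝ → ℝ) (hr : ContDiff ℝ (⊤ : ℕ∞) r) (χ : ℝ → ℝ)
    (hχ : ContDiff ℝ (⊤ : ℕ∞) χ) (lam : ℝ) (ρ : (ℝ × ℝ) × (ℝ × ℝ)) :
    fderiv ℝ (P6 r χ lam) ρ ((0, 1), (0, 0)) = r (ρ.1.1, ρ.2.1) * deriv χ ρ.1.2
      - 2 * lam * ρ.1.2 * Real.exp (-ρ.1.2 ^ 2) := by
  have hd := (aux_diff r hr χ hχ lam ρ).hasFDerivAt.hasLineDerivAt ((0, 1), (0, 0))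
  refine HasDerivAt.unique hd ?_
  obtain ⟨⟨x, y⟩, ⟨ξ, η⟩⟩ := ρ
  simp only [P6, Prod.smul_mk, Prod.mk_add_mk, smul_eq_mul, mul_zero, add_zero, mul_one]
  have h0 : HasDerivAt (fun t : ℝ => y + t) 1 0 := (hasDerivAt_id (0 : ℝ)).const_add y
  have hc : HasDerivAt χ (deriv χ y) (y + 0) := by
    rw [add_zero]
    exact (hχ.differentiable (by simp) y).hasDerivAt
  have := (((hc.comp (0 : ℝ) h0).const_mul (r (x, ξ))).const_add
    ((ξ ^ 2 - 1) * (ξ ^ 2 - 4) + η ^ 4 + η ^ 2)).add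
    (((h0.pow 2).neg.exp.sub_const 1).const_mul lam)
  refine this.congr_deriv ?_
  simp
  ring

theorem aux_nonpos (f f' : ℝ → ℝ) (hf : ∀ t, HasDerivAt f (f' t) t) (k : ℝ) (hk : 0 < k)
    (h : ∀ t, k * |f t| ≤ f' t) (B : ℝ) (hB : ∀ t, f t ≤ B) (t : ℝ) : f t ≤ 0 := by
  by_contra! hp
  have hm : Monotone f := monotone_of_hasDerivAt_nonneg hf
    (fun s => le_trans (by positivity) (h s))
  have hg : MonotoneOn (fun s => f s - (k * f t) * s) (Set.Ici t) := by
    have hd : ∀ s, HasDerivAt (fun s => f s - (k * f t) * s) (f' s - (k * f t) * 1) s :=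
      fun s => (hf s).sub ((hasDerivAt_id s).const_mul (k * f t))
    refine monotoneOn_of_deriv_nonneg (convex_Ici t)
      (fun s _ => (hd s).continuousAt.continuousWithinAt)
      (fun s _ => (hd s).differentiableAt.differentiableWithinAt) ?_
    intro s hs
    rw [interior_Ici] at hs
    rw [(hd s).deriv]
    have h1 := hm (le_of_lt hs)
    have h2 := h s
    have h3 := le_abs_self (f s)
    have h4 : k * f t ≤ k * |f s| := mul_le_mul_of_nonneg_left (h1.trans h3) hk.le
    linarith
  have hkf : 0 < k * f t := by positivity
  have hBt : 0 ≤ B := hp.le.trans (hB t)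
  have h1 := hg (Set.mem_Ici.2 le_rfl) (Set.mem_Ici.2 (show t ≤ t + B / (k * f t) from
    le_add_of_nonneg_right (by positivity))) (le_add_of_nonneg_right (by positivity))
  have h2 := hB (t + B / (k * f t))
  have h3 : (k * f t) * (B / (k * f t)) = B := by field_simp
  simp only [mul_add, h3] at h1
  linarith

theorem aux_zero (f f' : ℝ → ℝ) (hf : ∀ t, HasDerivAt f (f' t) t) (k : ℝ) (hk : 0 < k)
    (h : ∀ t, k * |f t| ≤ f' t) (B : ℝ) (hB : ∀ t, |f t| ≤ B) (t : ℝ) : f t = 0 := by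
  apply le_antisymm
  · exact aux_nonpos f f' hf k hk h B (fun s => (le_abs_self _).trans (hB s)) t
  · have := aux_nonpos (fun s => -f (-s)) (fun s => f' (-s)) (fun s => by
      have := ((hf (-s)).comp s (hasDerivAt_neg s)).neg
      refine this.congr_deriv (by ring)) k hk (fun s => by simpa using h (-s)) B
      (fun s => (neg_le_abs _).trans (hB (-s))) (-t)
    simpa using this

/-- Energy estimate. -/
theorem aux_energy (M D c lam ξ η r χy e : ℝ) (hM : 0 < M) (hD : 0 ≤ D) (hc : 0 < c)
    (hr : |r| ≤ M * (1 + ξ ^ 2) ^ ((3 : ℝ) / 2)) (hχ : χy ∈ Set.Icc (0 : ℝ) 1)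
    (he : 0 < e)
    (hl : (M * D / c) * (7 + M * D / c + M) ^ 3 + 1 ≤ lam)
    (hp : (ξ ^ 2 - 1) * (ξ ^ 2 - 4) + η ^ 4 + η ^ 2 + r * χy + lam * (e - 1) = 0) :
    |r| * D ≤ c * lam := by
  set u := Real.sqrt (1 + ξ ^ 2) with hu
  have hu2 : u ^ 2 = 1 + ξ ^ 2 := Real.sq_sqrt (by positivity)
  have hu1 : 1 ≤ u := by
    rw [hu]; exact Real.one_le_sqrt.2 (by nlinarith [sq_nonneg ξ])
  have hu3 : (1 + ξ ^ 2) ^ ((3 : ℝ) / 2) = u ^ 3 := by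
    rw [hu, Real.sqrt_eq_rpow, ← Real.rpow_natCast _ 3, ← Real.rpow_mul (by positivity)]
    norm_num
  rw [hu3] at hr
  set A := M * D / c with hA
  have hA0 : 0 ≤ A := by positivity
  have hAc : A * c = M * D := by rw [hA]; field_simp
  have hl0 : 0 < lam := lt_of_lt_of_le (by positivity) hl
  by_contra! hcon
  have h1 : |r| * D ≤ M * u ^ 3 * D := mul_le_mul_of_nonneg_right hr hD
  have h2 : c * lam < c * (A * u ^ 3) := by
    calc c * lam < M * u ^ 3 * D := lt_of_lt_of_le hcon h1
      _ = (A * c) * u ^ 3 := by rw [hAc]; ring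
      _ = _ := by ring
  have h3 : lam < A * u ^ 3 := lt_of_mul_lt_mul_left h2 hc.le
  have h4 : -(M * u ^ 3) ≤ r * χy := by
    have : |r * χy| ≤ M * u ^ 3 := by
      rw [abs_mul, abs_of_nonneg hχ.1]
      exact (mul_le_of_le_one_right (abs_nonneg r) hχ.2).trans hr
    exact (abs_le.1 this).1
  have h5 : 0 < lam * e := by positivity
  have h6 : (ξ ^ 2 - 1) * (ξ ^ 2 - 4) = u ^ 4 - 7 * u ^ 2 + 10 := by
    have : ξ ^ 2 = u ^ 2 - 1 := by linarith
    rw [this]; ring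
  have h7 : u ^ 2 ≤ u ^ 3 := pow_le_pow_right₀ hu1 (by norm_num)
  have h8 : u ^ 3 * u ≤ u ^ 3 * (7 + A + M) := by
    have := sq_nonneg η
    have := sq_nonneg (η ^ 2)
    nlinarith
  have h9 : u ≤ 7 + A + M := le_of_mul_le_mul_left h8 (by positivity)
  have h10 : A * u ^ 3 ≤ A * (7 + A + M) ^ 3 := by gcongr
  linarith

/-- For `λ` large enough, every bounded Hamiltonian trajectory of
`p = (ξ² − 1)(ξ² − 4) + η⁴ + η² + r(x,ξ)χ(y) + λ(e^{−y²} − 1)` contained in `p⁻¹(0)`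
satisfies `y ≡ 0` and `η ≡ 0`. -/
theorem stmt_6 (r : ℝ × ℝ → ℝ) (hr : ContDiff ℝ (⊤ : ℕ∞) r)
    (Kx : Set ℝ) (hKx : IsCompact Kx) (hrsupp : ∀ x ξ : ℝ, x ∉ Kx → r (x, ξ) = 0)
    (M : ℝ) (hM : 0 < M)
    (hrM : ∀ x ξ : ℝ, |r (x, ξ)| ≤ M * (1 + ξ ^ 2) ^ ((3 : ℝ) / 2))
    (χ : ℝ → ℝ) (hχ : ContDiff ℝ (⊤ : ℕ∞) χ) (hχc : HasCompactSupport χ)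
    (hχ01 : ∀ y, χ y ∈ Set.Icc (0 : ℝ) 1) (hχ1 : ∀ᶠ y in nhds (0 : ℝ), χ y = 1)
    (C : ℝ) (hC : 1 < C)
    (hχ' : ∀ y ∈ tsupport (deriv χ), 1 / C ≤ |y| ∧ |y| ≤ C) :
    ∃ lam0 : ℝ, 0 < lam0 ∧ ∀ lam : ℝ, lam0 ≤ lam →
      ∀ γ : ℝ → (ℝ × ℝ) × (ℝ × ℝ),
        (∀ t : ℝ, HasDerivAt γ (Hvf4 (P6 r χ lam) (γ t)) t) →
        Bornology.IsBounded (Set.range γ) →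
        (∀ t : ℝ, P6 r χ lam (γ t) = 0) →
        ∀ t : ℝ, (γ t).1.2 = 0 ∧ (γ t).2.2 = 0 := by
  obtain ⟨D, hD⟩ := hχc.deriv.exists_bound_of_continuous (hχ.continuous_deriv (by simp))
  have hD0 : 0 ≤ D := (norm_nonneg _).trans (hD 0)
  set c := 1 / C * Real.exp (-C ^ 2) with hc
  have hc0 : 0 < c := by positivity
  refine ⟨(M * D / c) * (7 + M * D / c + M) ^ 3 + 1, by positivity, ?_⟩
  intro lam hl γ hγ hb hz
  have hl0 : 0 < lam := lt_of_lt_of_le (by positivity) hl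
  obtain ⟨R, hR⟩ := hb.exists_norm_le
  have hR' : ∀ t, ‖γ t‖ ≤ R := fun t => hR _ ⟨t, rfl⟩
  have hR0 : 0 ≤ R := (norm_nonneg _).trans (hR' 0)
  have hy : ∀ t, |(γ t).1.2| ≤ R := fun t =>
    ((norm_snd_le (γ t).1).trans (norm_fst_le (γ t))).trans (hR' t)
  have hη : ∀ t, |(γ t).2.2| ≤ R := fun t =>
    ((norm_snd_le (γ t).2).trans (norm_snd_le (γ t))).trans (hR' t)
  have dy : ∀ t, HasDerivAt (fun t => (γ t).1.2) (4 * (γ t).2.2 ^ 3 + 2 * (γ t).2.2) t := by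
    intro t
    have := ((hγ t).hasFDerivAt.fst.snd).hasDerivAt
    refine this.congr_deriv ?_
    simp [Hvf4, aux_eta r hr χ hχ lam]
  have dη : ∀ t, HasDerivAt (fun t => (γ t).2.2) (-(r ((γ t).1.1, (γ t).2.1) * deriv χ (γ t).1.2
      - 2 * lam * (γ t).1.2 * Real.exp (-(γ t).1.2 ^ 2))) t := by
    intro t
    have := ((hγ t).hasFDerivAt.snd.snd).hasDerivAt
    refine this.congr_deriv ?_
    simp [Hvf4, aux_y r hr χ hχ lam]
  -- the key inequality
  have key : ∀ t, r ((γ t).1.1, (γ t).2.1) * deriv χ (γ t).1.2 * (γ t).1.2 ≤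
      lam * (γ t).1.2 ^ 2 * Real.exp (-(γ t).1.2 ^ 2) := by
    intro t
    have hE := aux_energy M D c lam (γ t).2.1 (γ t).2.2 (r ((γ t).1.1, (γ t).2.1)) (χ (γ t).1.2)
      (Real.exp (-(γ t).1.2 ^ 2)) hM hD0 hc0 (hrM _ _) (hχ01 _) (Real.exp_pos _) hl (hz t)
    generalize (γ t).1.2 = y at hE ⊢
    generalize r ((γ t).1.1, (γ t).2.1) = q at hE ⊢
    by_cases hys : y ∈ tsupport (deriv χ)
    · obtain ⟨h1, h2⟩ := hχ' y hys
      have h3 : |q * deriv χ y| ≤ c * lam := by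
        rw [abs_mul]
        exact (mul_le_mul_of_nonneg_left (hD y) (abs_nonneg q)).trans hE
      have h4 : c ≤ |y| * Real.exp (-y ^ 2) := by
        rw [hc]
        have h5 : y ^ 2 ≤ C ^ 2 := by
          rw [← sq_abs y]; gcongr
        gcongr
      calc q * deriv χ y * y ≤ |q * deriv χ y * y| := le_abs_self _
        _ = |q * deriv χ y| * |y| := abs_mul _ _
        _ ≤ (c * lam) * |y| := by gcongr
        _ ≤ (|y| * Real.exp (-y ^ 2) * lam) * |y| := by gcongr
        _ = lam * |y| ^ 2 * Real.exp (-y ^ 2) := by ring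
        _ = _ := by rw [sq_abs]
    · rw [image_eq_zero_of_notMem_tsupport hys]
      simp only [mul_zero, zero_mul]
      positivity
  set m := min 2 (lam * Real.exp (-R ^ 2)) with hm
  have hm0 : 0 < m := by rw [hm]; positivity
  have df : ∀ t, HasDerivAt (fun t => (γ t).1.2 * (γ t).2.2) _ t := fun t => (dy t).mul (dη t)
  have lower : ∀ t, m * ((γ t).1.2 ^ 2 + (γ t).2.2 ^ 2) ≤
      (4 * (γ t).2.2 ^ 3 + 2 * (γ t).2.2) * (γ t).2.2 + (γ t).1.2 *
      (-(r ((γ t).1.1, (γ t).2.1) * deriv χ (γ t).1.2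
      - 2 * lam * (γ t).1.2 * Real.exp (-(γ t).1.2 ^ 2))) := by
    intro t
    have hk := key t
    have h1 : (γ t).1.2 ^ 2 ≤ R ^ 2 := by
      rw [← sq_abs]; have := hy t; gcongr
    generalize (γ t).1.2 = y at hk h1 ⊢
    generalize r ((γ t).1.1, (γ t).2.1) = q at hk ⊢
    generalize (γ t).2.2 = η
    have h2 : m * η ^ 2 ≤ 2 * η ^ 2 := by gcongr; exact min_le_left _ _
    have h3 : m * y ^ 2 ≤ (lam * Real.exp (-y ^ 2)) * y ^ 2 := by
      gcongr
      refine (min_le_right _ _).trans ?_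
      gcongr
    have h4 : 0 ≤ η ^ 4 := by positivity
    nlinarith
  have hzero := aux_zero _ _ df m hm0 (fun t => by
    refine le_trans ?_ (lower t)
    gcongr
    rw [abs_mul]
    nlinarith [sq_nonneg (|(γ t).1.2| - |(γ t).2.2|), sq_abs (γ t).1.2, sq_abs (γ t).2.2,
      sq_nonneg (γ t).1.2, sq_nonneg (γ t).2.2]) (R * R) (fun t => by
    rw [abs_mul]
    exact mul_le_mul (hy t) (hη t) (abs_nonneg _) hR0)
  intro t
  have hf0 : (fun t => (γ t).1.2 * (γ t).2.2) = fun _ => (0 : ℝ) := funext hzero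
  have d0 := df t
  rw [hf0] at d0
  have e0 := d0.unique (hasDerivAt_const t (0 : ℝ))
  have hL := lower t
  rw [e0] at hL
  have hs : (γ t).1.2 ^ 2 + (γ t).2.2 ^ 2 ≤ 0 := by
    by_contra! hpos
    have := mul_pos hm0 hpos
    linarith
  constructor
  · exact pow_eq_zero_iff (two_ne_zero) |>.1 (by nlinarith [sq_nonneg (γ t).1.2, sq_nonneg (γ t).2.2])
  · exact pow_eq_zero_iff (two_ne_zero) |>.1 (by nlinarith [sq_nonneg (γ t).1.2, sq_nonneg (γ t).2.2])
end
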